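/- arXiv:1108.3638 — 3 statements merged into one kernel-verified Lean document; each statement's English description precedes it below -/
import Mathlib

section
/- Let w ∈ W be an element of a Coxeter group with ℓ(w) > 0, and let C(w) denote the number of commutation classes of reduced words for w. Then C(w) = Σ (-1)^{|T|+1} C(Tw), where the sum ranges over all nonempty independent subsets T of the left descent set D(w), and Tw denotes the product of the elements of T times w. -/
def SwapStep {S : Type*} (R : S → S → Prop) (u v : List S) : Prop :=
  ∃ (x y : List S) (a b : S), R a b ∧ u = x ++ a :: b :: y ∧ v = x ++ b :: a :: y

/-- The number of commutation classes of reduced words for `w`: the cardinality of the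
quotient of the set of reduced words for `w` by swaps of adjacent commuting generators
(generators `a`, `b` with `M a b = 2`). -/
noncomputable def CC {B : Type*} {W : Type*} [Group W] {M : CoxeterMatrix B}
    (cs : CoxeterSystem M W) (w : W) : ℕ :=
  Nat.card (Quot (fun u v : {ω : List B // cs.wordProd ω = w ∧ cs.IsReduced ω} =>
    SwapStep (fun a b => M a b = 2) u.1 v.1))

open scoped Classical in
/-- The product of an independent set `T` of generators (well defined by independence). -/
noncomputable def Tprod {B : Type*} {W : Type*} [Group W] {M : CoxeterMatrix B}
    (cs : CoxeterSystem M W) (T : Finset B) : W :=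
  if h : (T : Set B).Pairwise fun a b => Commute (cs.simple a) (cs.simple b)
  then T.noncommProd cs.simple fun a ha b hb hab => h ha hb hab
  else 1


section Geometric
open Polynomial Chebyshev

open scoped Classical in
noncomputable def geoForm {B : Type*} [Fintype B] (M : CoxeterMatrix B) (a : B) :
    Module.Dual ℝ (B → ℝ) :=
  ∑ c, (-2 * Real.cos (Real.pi / (M a c : ℝ))) • LinearMap.proj c

open scoped Classical in
lemma geoForm_single {B : Type*} [Fintype B] (M : CoxeterMatrix B) (a b : B) :
    geoForm M a (Pi.single b (1:ℝ)) = -2 * Real.cos (Real.pi / (M a b : ℝ)) := by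
  simp [geoForm, Pi.single_apply]

open scoped Classical in
lemma geoForm_self {B : Type*} [Fintype B] (M : CoxeterMatrix B) (a : B) :
    geoForm M a (Pi.single a (1:ℝ)) = 2 := by
  simp [geoForm_single]

lemma cheb_aux (m : ℕ) (hm : 3 ≤ m) (t : ℝ) (ht : t = 2 * Real.cos (2 * Real.pi / m)) :
    ((S ℝ (((m:ℤ) - 2) / 2)).eval t * ((S ℝ (((m:ℤ) - 1) / 2)).eval t
      + (S ℝ (((m:ℤ) - 3) / 2)).eval t)) = 0 ∧
    ((S ℝ (((m:ℤ) - 1) / 2)).eval t * ((S ℝ ((m:ℤ) / 2)).eval t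
      + (S ℝ (((m:ℤ) - 2) / 2)).eval t)) = 0 := by
  have hm' : (3:ℝ) ≤ m := by exact_mod_cast hm
  have hs : Real.sin (2 * Real.pi / m) ≠ 0 := by
    apply ne_of_gt
    apply Real.sin_pos_of_pos_of_lt_pi
    · positivity
    · rw [div_lt_iff₀ (by linarith)]
      nlinarith [Real.pi_pos]
  have key : ∀ n : ℤ, (S ℝ n).eval t * Real.sin (2 * Real.pi / m)
      = Real.sin ((n + 1) * (2 * Real.pi / m)) := by
    intro n; rw [ht]; exact S_two_mul_real_cos _ n
  rcases Nat.even_or_odd' m with ⟨k, rfl | rfl⟩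
  · have h0 : (S ℝ ((k:ℤ) - 1)).eval t = 0 := by
      have := key ((k:ℤ) - 1)
      have e : ((((k:ℤ) - 1 : ℤ) : ℝ) + 1) * (2 * Real.pi / ((2 * k : ℕ) : ℝ)) = Real.pi := by
        have : (k:ℝ) ≠ 0 := by
          intro h; push_cast at hm'; rw [h] at hm'; norm_num at hm'
        push_cast; field_simp; ring
      rw [e, Real.sin_pi] at this
      exact (mul_eq_zero.mp this).resolve_right hs
    have e1 : (((2 * k : ℕ) : ℤ) - 2) / 2 = k - 1 := by omega
    have e2 : (((2 * k : ℕ) : ℤ) - 1) / 2 = k - 1 := by omega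
    rw [e1, e2, h0]; simp
  · have h0 : (S ℝ (k:ℤ)).eval t + (S ℝ ((k:ℤ) - 1)).eval t = 0 := by
      have h1 := key ((k:ℤ) - 1)
      have h2 := key (k:ℤ)
      have e : Real.sin ((((k:ℤ) - 1 : ℤ) + 1) * (2 * Real.pi / ((2 * k + 1 : ℕ) : ℝ)))
          = - Real.sin ((((k:ℤ) : ℝ) + 1) * (2 * Real.pi / ((2 * k + 1 : ℕ) : ℝ))) := by
        rw [← Real.sin_sub_two_pi, ← Real.sin_neg]
        rw [← Real.sin_sub_two_pi]
        rw [← Real.sin_add_two_pi]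
        congr 1
        have : (2 * (k:ℝ) + 1) ≠ 0 := by positivity
        push_cast; field_simp; ring
      have h3 : ((S ℝ (k:ℤ)).eval t + (S ℝ ((k:ℤ) - 1)).eval t)
          * Real.sin (2 * Real.pi / ((2 * k + 1 : ℕ) : ℝ)) = 0 := by
        rw [add_mul, h1, h2, e]; ring
      exact (mul_eq_zero.mp h3).resolve_right hs
    have e1 : (((2 * k + 1 : ℕ) : ℤ) - 2) / 2 = k - 1 := by omega
    have e2 : (((2 * k + 1 : ℕ) : ℤ) - 1) / 2 = k := by omega
    have e3 : (((2 * k + 1 : ℕ) : ℤ) - 3) / 2 = k - 1 := by omega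
    have e4 : (((2 * k + 1 : ℕ) : ℤ)) / 2 = k := by omega
    rw [e1, e2, e3, e4, h0]; simp

open scoped Classical in
lemma geo_liftable {B : Type*} [Fintype B] (M : CoxeterMatrix B) :
    M.IsLiftable (fun a => Module.reflection (geoForm_self M a)) := by
  intro a b
  rcases eq_or_ne a b with rfl | hab
  · rw [M.diagonal a, pow_one]
    ext1 z
    exact Module.involutive_reflection (geoForm_self M a) z
  have h1 : M a b ≠ 1 := M.off_diagonal a b hab
  have hsymm : M b a = M a b := M.symmetric b a
  have hfy := geoForm_single M a b
  have hgx := geoForm_single M b a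
  rw [hsymm] at hgx
  ext1 z
  rcases Nat.lt_or_ge (M a b) 3 with h3 | h3
  · have : M a b = 0 ∨ M a b = 2 := by omega
    rcases this with h | h
    · rw [h]; simp
    · rw [h] at hfy hgx
      simp at hfy hgx
      rw [h, pow_two]
      simp only [LinearEquiv.mul_apply, Module.reflection_apply, map_sub, map_smul, hfy, hgx,
        geoForm_self, LinearEquiv.coe_one, id]
      module
  · have ht : 2 * Real.cos (2 * Real.pi / (M a b)) = geoForm M a (Pi.single b (1:ℝ)) *
        geoForm M b (Pi.single a (1:ℝ)) - 2 := by
      rw [hfy, hgx, mul_div_assoc, Real.cos_two_mul]; ring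
    rw [Module.reflection_mul_reflection_pow_apply _ _ _ _ _ ht]
    obtain ⟨e1, e2⟩ := cheb_aux (M a b) h3 _ rfl
    rw [e1, e2]; simp

lemma simple_inj {B : Type*} [Fintype B] {W : Type*} [Group W] {M : CoxeterMatrix B}
    (cs : CoxeterSystem M W) {a b : B} (hab : a ≠ b) : cs.simple a ≠ cs.simple b := by
  classical
  intro h
  have h2 := congrArg (cs.lift ⟨_, geo_liftable M⟩) h
  rw [cs.lift_apply_simple, cs.lift_apply_simple] at h2
  have h3 := congrFun (congrArg (fun e : (B → ℝ) ≃ₗ[ℝ] (B → ℝ) => e (Pi.single a (1:ℝ))) h2) a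
  simp only [Module.reflection_apply_self, Module.reflection_apply] at h3
  simp [hab] at h3
  norm_num at h3

end Geometric

section Exchange
variable {B : Type*} {W : Type*} [Group W] {M : CoxeterMatrix B} (cs : CoxeterSystem M W)

open scoped Classical in
noncomputable def permFun (a : B) (p : W × ZMod 2) : W × ZMod 2 :=
  (cs.simple a * p.1 * cs.simple a, p.2 + if p.1 = cs.simple a then 1 else 0)

open scoped Classical in
lemma permFun_mk (a : B) (g : W) (z : ZMod 2) : permFun cs a (g, z) =
    (cs.simple a * g * cs.simple a, z + if g = cs.simple a then 1 else 0) := rfl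

lemma permFun_permFun (a : B) (p : W × ZMod 2) : permFun cs a (permFun cs a p) = p := by
  obtain ⟨g, z⟩ := p
  have h : cs.simple a * g * cs.simple a = cs.simple a ↔ g = cs.simple a := by
    constructor
    · intro h
      have := congrArg (fun x => cs.simple a * x * cs.simple a) h
      simpa [mul_assoc] using this
    · rintro rfl; simp
  rw [permFun_mk, permFun_mk]
  simp only [Prod.mk.injEq]
  constructor
  · simp [mul_assoc]
  · by_cases hg : g = cs.simple a
    · rw [if_pos hg, if_pos (h.mpr hg), add_assoc, CharTwo.add_self_eq_zero, add_zero]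
    · rw [if_neg hg, if_neg (fun h' => hg (h.mp h'))]
      simp

noncomputable def permEquiv (a : B) : Equiv.Perm (W × ZMod 2) where
  toFun := permFun cs a
  invFun := permFun cs a
  left_inv := permFun_permFun cs a
  right_inv := permFun_permFun cs a

lemma simple_mul_pow (a b : B) (k : ℕ) :
    cs.simple b * (cs.simple a * cs.simple b) ^ k
      = ((cs.simple a * cs.simple b) ^ k)⁻¹ * cs.simple b := by
  induction k with
  | zero => simp
  | succ k ih =>
    rw [pow_succ, ← mul_assoc, ih]
    rw [← pow_succ, pow_succ']
    simp [mul_assoc]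

open scoped Classical in
lemma perm_pow_apply (a b : B) (k : ℕ) (g : W) (z : ZMod 2) :
    ((permEquiv cs a * permEquiv cs b) ^ k) (g, z) =
      ((cs.simple a * cs.simple b) ^ k * g * ((cs.simple a * cs.simple b) ^ k)⁻¹,
        z + ∑ i ∈ Finset.range (2 * k),
          if (cs.simple a * cs.simple b) ^ i * g = cs.simple b then 1 else 0) := by
  induction k with
  | zero => simp
  | succ k ih =>
    rw [pow_succ', Equiv.Perm.mul_apply, ih, Equiv.Perm.mul_apply]
    have key := simple_mul_pow cs a b k
    set r := cs.simple a * cs.simple b with hr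
    have hri : cs.simple b * cs.simple a = r⁻¹ := by simp [hr]
    have h1 : r ^ k * g * (r ^ k)⁻¹ = cs.simple b ↔ r ^ (2 * k) * g = cs.simple b := by
      rw [mul_inv_eq_iff_eq_mul, key, eq_inv_mul_iff_mul_eq, ← mul_assoc, ← pow_add, ← two_mul]
    have h2 : cs.simple b * (r ^ k * g * (r ^ k)⁻¹) * cs.simple b = cs.simple a
        ↔ r ^ (2 * k + 1) * g = cs.simple b := by
      have e : cs.simple b * (r ^ k * g * (r ^ k)⁻¹) * cs.simple b = cs.simple a
          ↔ r ^ k * g * (r ^ k)⁻¹ = r⁻¹ * cs.simple b := by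
        rw [← hri]
        constructor
        · intro h
          rw [← h]; simp [mul_assoc]
        · intro h
          rw [h]; simp [mul_assoc]
      rw [e, mul_inv_eq_iff_eq_mul, mul_assoc, key, eq_inv_mul_iff_mul_eq, eq_inv_mul_iff_mul_eq,
        show 2 * k + 1 = k + (1 + k) by ring, pow_add, pow_add, pow_one]
      simp only [mul_assoc]
    simp only [permEquiv, Equiv.coe_fn_mk, permFun, h1, h2]
    rw [show 2 * (k + 1) = 2 * k + 1 + 1 by ring, Finset.sum_range_succ, Finset.sum_range_succ]
    ext
    · simp only [pow_succ', mul_inv_rev]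
      rw [hr]; simp [mul_assoc]
    · simp only [add_assoc]

lemma perm_liftable : M.IsLiftable (permEquiv cs) := by
  classical
  intro a b
  ext1 ⟨g, z⟩
  rw [perm_pow_apply, two_mul, Finset.sum_range_add]
  simp only [pow_add, cs.simple_mul_simple_pow a b, one_mul, CharTwo.add_self_eq_zero]
  simp

open scoped Classical in
lemma perm_word (ω : List B) (g : W) (z : ZMod 2) :
    cs.lift ⟨_, perm_liftable cs⟩ (cs.wordProd ω) (g, z) =
      (cs.wordProd ω * g * (cs.wordProd ω)⁻¹, z + ((cs.rightInvSeq ω).count g : ZMod 2)) := by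
  induction ω with
  | nil => simp
  | cons i ω ih =>
    rw [cs.wordProd_cons, map_mul, Equiv.Perm.mul_apply, ih, cs.lift_apply_simple]
    simp only [permEquiv, Equiv.coe_fn_mk, permFun, CoxeterSystem.rightInvSeq, List.count_cons]
    ext
    · simp [mul_assoc]
    · have : cs.wordProd ω * g * (cs.wordProd ω)⁻¹ = cs.simple i ↔
        (cs.wordProd ω)⁻¹ * cs.simple i * cs.wordProd ω = g := by
        rw [mul_inv_eq_iff_eq_mul, mul_assoc, inv_mul_eq_iff_eq_mul, eq_comm]
      simp only [this, beq_iff_eq]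
      push_cast
      simp only [add_assoc]

lemma mem_ris_of_descent (ω : List B) (b : B) (h : cs.IsRightDescent (cs.wordProd ω) b) :
    cs.simple b ∈ cs.rightInvSeq ω := by
  classical
  obtain ⟨ν, hν, e⟩ := cs.exists_isReduced (cs.wordProd ω * cs.simple b)
  have hw : cs.wordProd (ν.concat b) = cs.wordProd ω := by
    rw [cs.wordProd_concat, ← e]; simp
  have hred : cs.IsReduced (ν.concat b) := by
    unfold CoxeterSystem.IsReduced
    rw [hw, ← (cs.isRightDescent_iff.mp h), e, hν.eq]; simp
  have h1 := perm_word cs ω (cs.simple b) 0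
  rw [← hw, perm_word] at h1
  have h2 := congrArg Prod.snd h1
  have hm : cs.simple b ∈ cs.rightInvSeq (ν.concat b) := by
    rw [cs.rightInvSeq_concat]; simp
  rw [List.count_eq_one_of_mem hred.nodup_rightInvSeq hm] at h2
  by_contra hc
  rw [List.count_eq_zero_of_not_mem hc] at h2
  simp at h2

lemma simple_comm {a b : B} (h : M a b = 2) : Commute (cs.simple a) (cs.simple b) := by
  have := cs.simple_mul_simple_pow a b
  rw [h, pow_two] at this
  have h2 := eq_inv_of_mul_eq_one_left this
  simpa [Commute, SemiconjBy] using h2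

lemma right_descent_step [Fintype B] {w : W} {a b : B} (hab : M a b = 2)
    (hb : cs.IsRightDescent w b) :
    cs.IsRightDescent (w * cs.simple a) b := by
  have hne : a ≠ b := by rintro rfl; simp at hab
  obtain ⟨ν, hν, e⟩ := cs.exists_isReduced (w * cs.simple a)
  have hw : cs.wordProd (ν.concat a) = w := by
    rw [cs.wordProd_concat, ← e]; simp
  have hm := mem_ris_of_descent cs (ν.concat a) b (by rw [hw]; exact hb)
  rw [cs.rightInvSeq_concat] at hm
  simp only [List.concat_eq_append, List.mem_append, List.mem_map, List.mem_singleton] at hm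
  rcases hm with ⟨t, ht, e2⟩ | h
  · have : t = cs.simple b := by
      have h3 : t = cs.simple a * cs.simple b * cs.simple a := by
        rw [← e2]; simp [mul_assoc]
      rw [h3, (simple_comm cs hab).eq]; simp
    subst this
    have := (cs.isRightInversion_of_mem_rightInvSeq hν ht).2
    rwa [← e] at this
  · exact absurd h.symm (simple_inj cs hne)

lemma left_descent_step [Fintype B] {w : W} {a b : B} (hab : M a b = 2)
    (hb : cs.IsLeftDescent w b) :
    cs.IsLeftDescent (cs.simple a * w) b := by
  rw [← cs.isRightDescent_inv_iff] at hb ⊢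
  have := right_descent_step cs hab hb
  simpa using this

lemma length_list_mul [Fintype B] (l : List B) (w : W) (hd : ∀ a ∈ l, cs.IsLeftDescent w a)
    (hp : l.Pairwise (fun a b => M a b = 2)) :
    cs.length ((cs.wordProd l)⁻¹ * w) + l.length = cs.length w := by
  induction l generalizing w with
  | nil => simp
  | cons a l ih =>
    rw [List.pairwise_cons] at hp
    have ha := hd a (by simp)
    have := ih (cs.simple a * w) (fun b hb => left_descent_step cs (hp.1 b hb)
      (hd b (by simp [hb]))) hp.2
    rw [cs.wordProd_cons, mul_inv_rev, cs.inv_simple, mul_assoc, List.length_cons, ← add_assoc,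
      this]
    exact cs.isLeftDescent_iff.mp ha

end Exchange

section Traces
variable {B : Type*} (M : CoxeterMatrix B)

def Sim (u v : List B) : Prop := Relation.ReflTransGen (SwapStep (fun a b => M a b = 2)) u v

def Front (a : B) : List B → Prop
  | [] => False
  | b :: v => b = a ∨ (M a b = 2 ∧ Front a v)

variable {M}

lemma swap_symm {u v : List B} (h : SwapStep (fun a b => M a b = 2) u v) :
    SwapStep (fun a b => M a b = 2) v u := by
  obtain ⟨x, y, a, b, h, rfl, rfl⟩ := h
  exact ⟨x, y, b, a, (M.symmetric b a).trans h, rfl, rfl⟩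

lemma swap_cons {u v : List B} (c : B) (h : SwapStep (fun a b => M a b = 2) u v) :
    SwapStep (fun a b => M a b = 2) (c :: u) (c :: v) := by
  obtain ⟨x, y, a, b, h, rfl, rfl⟩ := h
  exact ⟨c :: x, y, a, b, h, rfl, rfl⟩

lemma Sim.symm {u v : List B} (h : Sim M u v) : Sim M v u := by
  induction h with
  | refl => exact .refl
  | tail _ h ih => exact Relation.ReflTransGen.head (swap_symm h) ih

lemma Sim.trans {u v w : List B} (h : Sim M u v) (h' : Sim M v w) : Sim M u w :=
  Relation.ReflTransGen.trans h h'

lemma Sim.cons {u v : List B} (c : B) (h : Sim M u v) : Sim M (c :: u) (c :: v) := by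
  induction h with
  | refl => exact .refl
  | tail _ h ih => exact Relation.ReflTransGen.tail ih (swap_cons c h)

lemma Sim.append {u v : List B} (l : List B) (h : Sim M u v) : Sim M (l ++ u) (l ++ v) := by
  induction l with
  | nil => exact h
  | cons a l ih => exact ih.cons a

lemma Front.swap {a : B} {u v : List B} (h : SwapStep (fun a b => M a b = 2) u v)
    (hu : Front M a u) : Front M a v := by
  obtain ⟨x, y, p, q, h, rfl, rfl⟩ := h
  induction x with
  | nil =>
    have h' : M q p = 2 := by rw [M.symmetric q p]; exact h
    simp only [List.nil_append, Front] at hu ⊢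
    rcases hu with rfl | ⟨h1, rfl | ⟨h2, h3⟩⟩
    · exact Or.inr ⟨h, Or.inl rfl⟩
    · exact Or.inl rfl
    · exact Or.inr ⟨h2, Or.inr ⟨h1, h3⟩⟩
  | cons c x ih =>
    simp only [List.cons_append, Front] at hu ⊢
    rcases hu with h1 | ⟨h1, h2⟩
    · exact Or.inl h1
    · exact Or.inr ⟨h1, ih h2⟩

lemma Front.sim {a : B} {u v : List B} (h : Sim M u v) (hu : Front M a u) : Front M a v := by
  induction h with
  | refl => exact hu
  | tail _ h ih => exact ih.swap h

open scoped Classical in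
lemma swap_erase (a : B) {u v : List B} (h : SwapStep (fun a b => M a b = 2) u v) :
    Sim M (u.erase a) (v.erase a) := by
  obtain ⟨x, y, p, q, h, rfl, rfl⟩ := h
  induction x with
  | nil =>
    have hpq : p ≠ q := by rintro rfl; simp at h
    simp only [List.nil_append]
    by_cases hp : p = a
    · subst hp
      rw [List.erase_cons_head, List.erase_cons_tail (by simpa using hpq.symm),
        List.erase_cons_head]
      exact .refl
    · by_cases hq : q = a
      · subst hq
        rw [List.erase_cons_head, List.erase_cons_tail (by simpa using hpq),
          List.erase_cons_head]
        exact .refl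
      · rw [List.erase_cons_tail (by simpa using hp), List.erase_cons_tail (by simpa using hq),
          List.erase_cons_tail (by simpa using hq), List.erase_cons_tail (by simpa using hp)]
        exact .single ⟨[], _, p, q, h, rfl, rfl⟩
  | cons c x ih =>
    simp only [List.cons_append]
    by_cases hc : c = a
    · subst hc
      rw [List.erase_cons_head, List.erase_cons_head]
      exact .single ⟨x, y, p, q, h, rfl, rfl⟩
    · rw [List.erase_cons_tail (by simpa using hc), List.erase_cons_tail (by simpa using hc)]
      exact ih.cons c

open scoped Classical in
lemma Sim.erase (a : B) {u v : List B} (h : Sim M u v) : Sim M (u.erase a) (v.erase a) := by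
  induction h with
  | refl => exact .refl
  | tail _ h ih => exact ih.trans (swap_erase a h)

lemma Sim.of_cons {a : B} {u v : List B} (h : Sim M (a :: u) (a :: v)) : Sim M u v := by
  classical
  simpa using h.erase a

lemma Sim.of_append {l : List B} {u v : List B} (h : Sim M (l ++ u) (l ++ v)) : Sim M u v := by
  induction l with
  | nil => exact h
  | cons a l ih => exact ih h.of_cons

lemma Front.exists_sim {a : B} {u : List B} (h : Front M a u) : ∃ v, Sim M u (a :: v) := by
  induction u with
  | nil => exact h.elim
  | cons b u ih =>
    rcases h with rfl | ⟨h1, h2⟩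
    · exact ⟨u, .refl⟩
    · obtain ⟨v, hv⟩ := ih h2
      exact ⟨b :: v, (hv.cons b).trans (.single ⟨[], v, b, a, (M.symmetric b a).trans h1,
        rfl, rfl⟩)⟩

lemma Front.comm {a b : B} {u : List B} (ha : Front M a u) (hb : Front M b u) (hab : a ≠ b) :
    M a b = 2 := by
  obtain ⟨v, hv⟩ := hb.exists_sim
  rcases ha.sim hv with h | ⟨h, _⟩
  · exact absurd h.symm hab
  · exact h

lemma fronts_exists_sim (l : List B) (u : List B) (hf : ∀ a ∈ l, Front M a u)
    (hp : l.Pairwise (fun a b => M a b = 2)) : ∃ v, Sim M u (l ++ v) := by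
  induction l generalizing u with
  | nil => exact ⟨u, .refl⟩
  | cons a l ih =>
    rw [List.pairwise_cons] at hp
    obtain ⟨v, hv⟩ := (hf a (by simp)).exists_sim
    obtain ⟨v', hv'⟩ := ih v (fun b hb => by
      rcases (hf b (by simp [hb])).sim hv with h | ⟨_, h⟩
      · have := hp.1 b hb
        rw [h] at this; simp at this
      · exact h) hp.2
    exact ⟨v', hv.trans (hv'.cons a)⟩

lemma front_append (l : List B) (v : List B) (hp : l.Pairwise (fun a b => M a b = 2)) :
    ∀ a ∈ l, Front M a (l ++ v) := by
  induction l with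
  | nil => simp
  | cons b l ih =>
    rw [List.pairwise_cons] at hp
    intro a ha
    rcases List.mem_cons.mp ha with rfl | ha
    · exact Or.inl rfl
    · exact Or.inr ⟨by rw [M.symmetric a b]; exact hp.1 a ha, ih hp.2 a ha⟩

end Traces

section Count
variable {B : Type*} {W : Type*} [Group W] {M : CoxeterMatrix B} (cs : CoxeterSystem M W)

abbrev RedWord (w : W) : Type _ := {ω : List B // cs.wordProd ω = w ∧ cs.IsReduced ω}

abbrev CClass (w : W) : Type _ := Quot (fun u v : RedWord cs w =>
    SwapStep (fun a b => M a b = 2) u.1 v.1)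

lemma swap_wordProd {u v : List B} (h : SwapStep (fun a b => M a b = 2) u v) :
    cs.wordProd u = cs.wordProd v ∧ u.length = v.length := by
  obtain ⟨x, y, a, b, h, rfl, rfl⟩ := h
  constructor
  · simp only [cs.wordProd_append, cs.wordProd_cons]
    rw [← mul_assoc (cs.simple a), (simple_comm cs h).eq, mul_assoc (cs.simple b)]
  · simp

lemma sim_red {w : W} (u : RedWord cs w) {v : List B} (h : Sim M u.1 v) :
    ∃ hv : cs.wordProd v = w ∧ cs.IsReduced v,
      (Quot.mk _ u : CClass cs w) = Quot.mk _ ⟨v, hv⟩ := by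
  induction h with
  | refl => exact ⟨u.2, rfl⟩
  | tail _ h ih =>
    obtain ⟨hv, e⟩ := ih
    obtain ⟨h1, h2⟩ := swap_wordProd cs h
    refine ⟨⟨h1 ▸ hv.1, ?_⟩, e.trans (Quot.sound h)⟩
    unfold CoxeterSystem.IsReduced
    rw [← h1, ← h2]; exact hv.2

lemma quot_eq_iff {w : W} (u v : RedWord cs w) :
    (Quot.mk _ u : CClass cs w) = Quot.mk _ v ↔ Sim M u.1 v.1 := by
  constructor
  · intro h
    have := Quot.eqvGen_exact h
    clear h
    induction this with
    | rel _ _ h => exact .single h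
    | refl => exact .refl
    | symm _ _ _ ih => exact ih.symm
    | trans _ _ _ _ _ ih1 ih2 => exact ih1.trans ih2
  · intro h
    exact (sim_red cs u h).2

def CFront {w : W} (a : B) (c : CClass cs w) : Prop :=
  Quot.lift (fun u : RedWord cs w => Front M a u.1)
    (fun _ _ h => propext ⟨fun h' => h'.swap h, fun h' => h'.swap (swap_symm h)⟩) c

lemma CFront.descent {w : W} {a : B} {c : CClass cs w} (h : CFront cs a c) :
    cs.IsLeftDescent w a := by
  induction c using Quot.ind with
  | mk u =>
    obtain ⟨v, hv⟩ := Front.exists_sim (show Front M a u.1 from h)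
    obtain ⟨⟨h1, h2⟩, -⟩ := sim_red cs u hv
    unfold CoxeterSystem.IsLeftDescent
    have h3 : cs.length w = v.length + 1 := by
      rw [← h1, h2.eq]; simp
    have h4 : cs.simple a * w = cs.wordProd v := by
      rw [← h1, cs.wordProd_cons]; simp
    rw [h3, h4]
    exact Nat.lt_succ_of_le (cs.length_wordProd_le v)

lemma CFront.comm {w : W} {a b : B} {c : CClass cs w} (h : CFront cs a c) (h' : CFront cs b c)
    (hab : a ≠ b) : M a b = 2 := by
  induction c using Quot.ind with
  | mk u => exact Front.comm h h' hab

lemma CFront.exists {w : W} (hw : 0 < cs.length w) (c : CClass cs w) : ∃ a, CFront cs a c := by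
  induction c using Quot.ind with
  | mk u =>
    obtain ⟨u, h1, h2⟩ := u
    cases u with
    | nil => simp at h1; rw [← h1] at hw; simp at hw
    | cons a u => exact ⟨a, Or.inl rfl⟩

instance finite_CClass [Finite B] (w : W) : Finite (CClass cs w) := by
  have : Finite (RedWord cs w) := by
    refine Set.Finite.subset (List.finite_length_eq B (cs.length w)) ?_
    rintro ω ⟨h1, h2⟩
    show ω.length = _
    rw [← h1, h2.eq]
  exact Quot.finite _

lemma card_fronts [Fintype B] (w : W) (l : List B) (hd : ∀ a ∈ l, cs.IsLeftDescent w a)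
    (hp : l.Pairwise (fun a b => M a b = 2)) :
    CC cs ((cs.wordProd l)⁻¹ * w) = Nat.card {c : CClass cs w // ∀ a ∈ l, CFront cs a c} := by
  have hlen := length_list_mul cs l w hd hp
  have hok : ∀ u : RedWord cs ((cs.wordProd l)⁻¹ * w),
      cs.wordProd (l ++ u.1) = w ∧ cs.IsReduced (l ++ u.1) := by
    rintro ⟨u, h1, h2⟩
    have h3 : cs.wordProd (l ++ u) = w := by rw [cs.wordProd_append, h1]; simp
    refine ⟨h3, ?_⟩
    unfold CoxeterSystem.IsReduced
    have h4 := h2.eq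
    rw [h1] at h4
    rw [h3, List.length_append, ← hlen, h4, add_comm]
  let f : CClass cs ((cs.wordProd l)⁻¹ * w) → {c : CClass cs w // ∀ a ∈ l, CFront cs a c} :=
    Quot.lift (fun u => ⟨Quot.mk _ ⟨l ++ u.1, hok u⟩, fun a ha => front_append l u.1 hp a ha⟩)
      (fun u v h => Subtype.ext ((quot_eq_iff cs _ _).mpr (Sim.append l (.single h))))
  refine Nat.card_congr (Equiv.ofBijective f ⟨?_, ?_⟩)
  · intro c d
    induction c using Quot.ind with
    | mk u =>
      induction d using Quot.ind with
      | mk v =>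
        intro h
        have h2 := (quot_eq_iff cs _ _).mp (congrArg Subtype.val h)
        exact (quot_eq_iff cs _ _).mpr (Sim.of_append h2)
  · rintro ⟨c, hc⟩
    induction c using Quot.ind with
    | mk u =>
      obtain ⟨v, hv⟩ := fronts_exists_sim l u.1 hc hp
      obtain ⟨⟨h1, h2⟩, e⟩ := sim_red cs u hv
      have h3 : cs.wordProd v = (cs.wordProd l)⁻¹ * w := by
        rw [← h1, cs.wordProd_append]; simp
      have h4 : cs.IsReduced v := by
        have := h2.drop l.length
        simpa using this
      exact ⟨Quot.mk _ ⟨v, h3, h4⟩, Subtype.ext e.symm⟩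

lemma Tprod_eq (T : Finset B) (hT : ∀ a ∈ T, ∀ b ∈ T, a ≠ b → M a b = 2) :
    Tprod cs T = (cs.wordProd T.toList)⁻¹ := by
  classical
  have h : (T : Set B).Pairwise fun a b => Commute (cs.simple a) (cs.simple b) :=
    fun a ha b hb hab => simple_comm cs (hT a ha b hb hab)
  rw [← cs.wordProd_reverse, Tprod, dif_pos h, CoxeterSystem.wordProd]
  have e : T.toList.reverse.toFinset = T := by simp
  rw [← Finset.noncommProd_toFinset T.toList.reverse cs.simple (by rw [e]; exact h)
    (List.nodup_reverse.mpr T.nodup_toList)]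
  congr 1
  exact e.symm

end Count

open scoped Classical in
/-- The inclusion-exclusion recursion
`C(w) = Σ_{∅ ≠ T ⊆ D(w), T independent} (-1)^{|T|+1} C(Tw)`. -/
theorem stmt9 {B : Type*} [Fintype B] {W : Type*} [Group W] {M : CoxeterMatrix B}
    (cs : CoxeterSystem M W) (w : W) (hw : 0 < cs.length w) :
    (CC cs w : ℤ) =
      ∑ T ∈ Finset.univ.powerset.filter
          (fun T : Finset B => T.Nonempty ∧ (∀ a ∈ T, cs.IsLeftDescent w a) ∧
            ∀ a ∈ T, ∀ b ∈ T, a ≠ b → M a b = 2),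
        (-1 : ℤ) ^ (T.card + 1) * CC cs (Tprod cs T * w) := by
  have : Fintype (CClass cs w) := Fintype.ofFinite _
  set D := Finset.univ.powerset.filter
          (fun T : Finset B => T.Nonempty ∧ (∀ a ∈ T, cs.IsLeftDescent w a) ∧
            ∀ a ∈ T, ∀ b ∈ T, a ≠ b → M a b = 2) with hD
  have h1 : ∀ T ∈ D, (-1 : ℤ) ^ (T.card + 1) * CC cs (Tprod cs T * w) =
      ∑ c : CClass cs w, if (∀ a ∈ T, CFront cs a c) then (-1 : ℤ) ^ (T.card + 1) else 0 := by
    intro T hT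
    obtain ⟨-, -, hd, hp⟩ := Finset.mem_filter.mp hT
    rw [Tprod_eq cs T hp, card_fronts cs w T.toList (by simpa using hd)
      (T.nodup_toList.pairwise_of_forall_ne (by simpa using hp)),
      ← Finset.sum_filter, Finset.sum_const, Nat.card_eq_fintype_card, Fintype.card_subtype,
      nsmul_eq_mul, mul_comm]
    simp only [Finset.mem_toList]
  rw [Finset.sum_congr rfl h1, Finset.sum_comm]
  have h2 : ∀ c : CClass cs w, (∑ T ∈ D, if (∀ a ∈ T, CFront cs a c) then
      (-1 : ℤ) ^ (T.card + 1) else 0) = 1 := by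
    intro c
    set F := Finset.univ.filter (fun a => CFront cs a c) with hF
    have hne : F.Nonempty := by
      obtain ⟨a, ha⟩ := CFront.exists cs hw c
      exact ⟨a, by simp [hF, ha]⟩
    rw [← Finset.sum_filter]
    have e : D.filter (fun T => ∀ a ∈ T, CFront cs a c) = F.powerset.erase ∅ := by
      ext T
      simp only [hD, hF, Finset.mem_filter, Finset.mem_erase, Finset.mem_powerset,
        Finset.subset_iff, Finset.mem_univ, true_and, Finset.nonempty_iff_ne_empty]
      constructor
      · rintro ⟨⟨-, h, -⟩, h'⟩
        exact ⟨h, fun a ha => h' a ha⟩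
      · rintro ⟨h, h'⟩
        refine ⟨⟨by simp, h, fun a ha => (h' a ha).descent cs, fun a ha b hb hab =>
          (h' a ha).comm cs (h' b hb) hab⟩, fun a ha => h' a ha⟩
    rw [e]
    have h3 := Finset.sum_powerset_neg_one_pow_card_of_nonempty hne
    rw [← Finset.add_sum_erase _ _ (Finset.empty_mem_powerset F)] at h3
    simp only [pow_succ, ← Finset.sum_mul]
    simp only [Finset.card_empty, pow_zero] at h3
    linarith
  rw [Finset.sum_congr rfl (fun c _ => h2 c)]
  simp [CC, Nat.card_eq_fintype_card]
end

section
/- Let M(k) denote the maximum, over all Coxeter groups and all elements w of length k, of the number of commutation classes of reduced words for w. Then M(0) = M(1) = M(2) = 1, M(3) = M(4) = 2, M(5) = 3, and M(6) = 8. -/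
/-- `M(k)`: the maximum, over all Coxeter groups and all elements `w` of length `k`, of
the number of commutation classes of reduced words for `w`. -/
noncomputable def Mnum (k : ℕ) : ℕ :=
  sSup {n : ℕ | ∃ (B : Type) (M : CoxeterMatrix B) (w : M.Group),
    M.toCoxeterSystem.length w = k ∧ CC M.toCoxeterSystem w = n}

namespace CoxCount

/-! ### The geometric representation -/

section Geom

variable {B : Type*} (M : CoxeterMatrix B)

/-- Coefficient `-2 cos (π / M s t)`. -/
noncomputable def coef (s t : B) : ℝ := -2 * Real.cos (Real.pi / M s t)

/-- The coroot functional. -/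
noncomputable def coroot (s : B) : Module.Dual ℝ (B →₀ ℝ) :=
  Finsupp.linearCombination ℝ (coef M s)

/-- The simple root. -/
noncomputable def root (s : B) : B →₀ ℝ := Finsupp.single s 1

lemma coroot_root (s t : B) : coroot M s (root t) = coef M s t := by
  simp [coroot, root]

lemma coroot_self (s : B) : coroot M s (root s) = 2 := by
  rw [coroot_root]; simp [coef]

lemma coef_self (s : B) : coef M s s = 2 := by simp [coef]

lemma coef_symm (s t : B) : coef M s t = coef M t s := by
  simp [coef, M.symmetric s t]

lemma M_cases {s t : B} (h : s ≠ t) : M s t = 0 ∨ M s t = 2 ∨ 3 ≤ M s t := by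
  have := M.off_diagonal s t h
  omega

/-- The simple reflection of the geometric representation. -/
noncomputable def refl (s : B) : (B →₀ ℝ) ≃ₗ[ℝ] (B →₀ ℝ) := Module.reflection (coroot_self M s)

open Polynomial.Chebyshev in
lemma refl_liftable : M.IsLiftable (refl M) := by
  intro s t
  by_cases hst : s = t
  · subst hst
    simp only [M.diagonal, pow_one, refl]
    ext1 z
    exact Module.involutive_reflection (coroot_self M s) z
  have key := fun z u hu => Module.reflection_mul_reflection_pow_apply (coroot_self M s)
    (coroot_self M t) (M s t) z u hu
  rcases M_cases M hst with h | h | h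
  · simp [h]
  · have c : coef M s t = 0 := by simp [coef, h]
    have c' : coef M t s = 0 := by rw [coef_symm, c]
    ext1 z
    refine (key z (-2) (by simp [coroot_root, c])).trans ?_
    rw [h]
    norm_num [coroot_root, c, c']
    module
  · ext1 z
    set m := M s t with hm
    have m3 : (3 : ℝ) ≤ m := by exact_mod_cast h
    set θ : ℝ := 2 * (Real.pi / m) with hθ
    have mθ : m * θ = 2 * Real.pi := by rw [hθ]; field_simp
    have hsin : Real.sin θ ≠ 0 := by
      apply ne_of_gt
      apply Real.sin_pos_of_pos_of_lt_pi
      · positivity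
      · have := Real.pi_pos
        nlinarith
    have ht : 2 * Real.cos θ = coroot M s (root t) * coroot M t (root s) - 2 := by
      rw [coroot_root, coroot_root, coef_symm M t s, coef, hθ, Real.cos_two_mul]
      ring
    have hS : ∀ n : ℤ, (S ℝ n).eval (2 * Real.cos θ) = Real.sin ((n + 1) * θ) / Real.sin θ := by
      intro n
      rw [eq_div_iff hsin]
      exact S_two_mul_real_cos θ n
    refine (key z _ ht).trans ?_
    rcases Nat.even_or_odd' m with ⟨k, hk | hk⟩
    · have e1 : ((m : ℤ) - 2) / 2 = k - 1 := by omega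
      have e2 : ((m : ℤ) - 1) / 2 = k - 1 := by omega
      have z0 : (S ℝ ((k : ℤ) - 1)).eval (2 * Real.cos θ) = 0 := by
        rw [hS]
        have : ((((k : ℤ) - 1 : ℤ) : ℝ) + 1) * θ = Real.pi := by
          push_cast
          have : (m : ℝ) = 2 * k := by exact_mod_cast hk
          rw [this] at mθ
          linarith
        rw [this]; simp
      rw [e1, e2, z0]
      simp
    · have e1 : ((m : ℤ) - 2) / 2 = k - 1 := by omega
      have e2 : ((m : ℤ) - 1) / 2 = k := by omega
      have e3 : ((m : ℤ) - 3) / 2 = k - 1 := by omega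
      have e4 : (m : ℤ) / 2 = k := by omega
      have z0 : (S ℝ (k : ℤ)).eval (2 * Real.cos θ) +
          (S ℝ ((k : ℤ) - 1)).eval (2 * Real.cos θ) = 0 := by
        rw [hS, hS]
        have : (((k : ℤ) : ℝ) + 1) * θ = 2 * Real.pi - (((k : ℤ) - 1 : ℤ) + 1) * θ := by
          push_cast
          have : (m : ℝ) = 2 * k + 1 := by exact_mod_cast hk
          rw [this] at mθ
          linarith
        rw [this, Real.sin_two_pi_sub]
        ring
      rw [e1, e2, e3, e4, z0]
      simp

variable {M} {W : Type*} [Group W] (cs : CoxeterSystem M W)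

/-- The geometric representation. -/
noncomputable def geom : W →* ((B →₀ ℝ) ≃ₗ[ℝ] (B →₀ ℝ)) := cs.lift ⟨refl M, refl_liftable M⟩

lemma geom_simple (s : B) (v : B →₀ ℝ) :
    geom cs (cs.simple s) v = v - coroot M s v • root s := by
  rw [geom, cs.lift_apply_simple (refl_liftable M)]
  simp [refl, Module.reflection_apply]

lemma commute_imp {s t : B} (hst : s ≠ t)
    (h : cs.simple s * cs.simple t = cs.simple t * cs.simple s) : M s t = 2 := by
  have h1 : geom cs (cs.simple s) (geom cs (cs.simple t) (root t)) =
      geom cs (cs.simple t) (geom cs (cs.simple s) (root t)) := by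
    rw [← LinearEquiv.mul_apply, ← LinearEquiv.mul_apply, ← map_mul, ← map_mul, h]
  have h2 := DFunLike.congr_fun h1 s
  simp only [geom_simple, map_sub, map_smul, coroot_root, coef_self] at h2
  simp [root, hst] at h2
  have h3 : coef M s t = 0 := by linarith
  rcases M_cases M hst with h | h | h
  · simp [coef, h] at h3
  · exact h
  · exfalso
    have m3 : (3 : ℝ) ≤ M s t := by exact_mod_cast h
    have : 0 < Real.cos (Real.pi / M s t) := by
      apply Real.cos_pos_of_mem_Ioo
      have hp := Real.pi_pos
      constructor
      · have : 0 < Real.pi / M s t := by positivity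
        linarith
      · apply div_lt_div_of_pos_left hp <;> linarith
    rw [coef] at h3
    linarith

lemma braid_imp {s t : B} (hst : s ≠ t)
    (h : cs.simple s * cs.simple t * cs.simple s = cs.simple t * cs.simple s * cs.simple t) :
    M s t = 3 := by
  have h1 : geom cs (cs.simple s) (geom cs (cs.simple t) (geom cs (cs.simple s) (root s))) =
      geom cs (cs.simple t) (geom cs (cs.simple s) (geom cs (cs.simple t) (root s))) := by
    rw [← LinearEquiv.mul_apply, ← LinearEquiv.mul_apply, ← LinearEquiv.mul_apply,
      ← LinearEquiv.mul_apply, ← map_mul, ← map_mul, ← map_mul, ← map_mul, h]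
  have h2 := DFunLike.congr_fun h1 s
  simp only [geom_simple, map_sub, map_smul, coroot_root, coef_self, coef_symm M t s] at h2
  simp [root, hst] at h2
  simp only [coef] at h2
  have h3 : Real.cos (Real.pi / M s t) ^ 2 = 1 / 4 := by linarith
  rcases M_cases M hst with h | h | h
  · simp [h] at h3
  · simp [h] at h3
  · by_contra hne
    have m4 : (4 : ℝ) ≤ M s t := by exact_mod_cast (show 4 ≤ M s t by omega)
    have hp := Real.pi_pos
    have : Real.cos (Real.pi / 3) < Real.cos (Real.pi / M s t) := by
      apply Real.cos_lt_cos_of_nonneg_of_le_pi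
      · positivity
      · linarith
      · apply div_lt_div_of_pos_left hp <;> linarith
    rw [Real.cos_pi_div_three] at this
    nlinarith

lemma simple_inj {s t : B} (h : cs.simple s = cs.simple t) : s = t := by
  by_contra hst
  have h1 := commute_imp cs hst (by rw [h])
  have h2 := braid_imp cs hst (by rw [h])
  omega

end Geom


end CoxCount

namespace CoxCount

/-! ### The exchange condition -/

section Exchange

variable {B : Type*} {M : CoxeterMatrix B} {W : Type*} [Group W] (cs : CoxeterSystem M W)

open Classical in
/-- The action on `W × ZMod 2` that records parities of inversions. -/
noncomputable def act (s : B) : Function.End (W × ZMod 2) :=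
  fun p => (cs.simple s * p.1 * cs.simple s, p.2 + if p.1 = cs.simple s then 1 else 0)

open Classical in
lemma act_pow (s t : B) (n : ℕ) (x : W) (e : ZMod 2) :
    ((act cs s * act cs t) ^ n) (x, e) =
      ((cs.simple s * cs.simple t) ^ n * x * (cs.simple t * cs.simple s) ^ n,
        e + ∑ j ∈ Finset.range (2 * n),
          if x * cs.simple t = (cs.simple t * cs.simple s) ^ j then 1 else 0) := by
  have inv1 : ∀ n : ℕ, ((cs.simple s * cs.simple t) ^ n)⁻¹ = (cs.simple t * cs.simple s) ^ n := by
    intro n; rw [← inv_pow]; simp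
  have flip : ∀ n : ℕ, cs.simple t * (cs.simple s * cs.simple t) ^ n =
      (cs.simple t * cs.simple s) ^ n * cs.simple t := by
    intro n
    induction n with
    | zero => simp
    | succ n ih => rw [pow_succ, pow_succ, ← mul_assoc, ih]; simp [mul_assoc]
  have fin : ∀ P : W, x = P * cs.simple t ↔ x * cs.simple t = P := by
    intro P
    constructor
    · rintro rfl; simp
    · rintro rfl; simp
  induction n with
  | zero => simp; rfl
  | succ n ih =>
    rw [pow_succ', show 2 * (n + 1) = 2 * n + 1 + 1 by ring, Finset.sum_range_succ,
      Finset.sum_range_succ]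
    change act cs s (act cs t (((act cs s * act cs t) ^ n) (x, e))) = _
    rw [ih]
    simp only [act]
    have c1 : ((cs.simple s * cs.simple t) ^ n * x * (cs.simple t * cs.simple s) ^ n = cs.simple t)
        ↔ x * cs.simple t = (cs.simple t * cs.simple s) ^ (2 * n) := by
      rw [← inv1 n, mul_inv_eq_iff_eq_mul, flip, ← eq_inv_mul_iff_mul_eq, inv1, ← mul_assoc,
        ← pow_add, ← two_mul, fin]
    have c2 : (cs.simple t * ((cs.simple s * cs.simple t) ^ n * x *
        (cs.simple t * cs.simple s) ^ n) * cs.simple t = cs.simple s)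
        ↔ x * cs.simple t = (cs.simple t * cs.simple s) ^ (2 * n + 1) := by
      rw [← eq_mul_inv_iff_mul_eq, ← eq_inv_mul_iff_mul_eq, ← inv1 n, mul_inv_eq_iff_eq_mul,
        cs.inv_simple, mul_assoc, mul_assoc, flip, ← mul_assoc, ← mul_assoc, ← pow_succ',
        ← eq_inv_mul_iff_mul_eq, inv1, ← mul_assoc, ← pow_add, show n + (n + 1) = 2 * n + 1 by ring,
        fin]
    simp only [c1, c2]
    refine Prod.ext ?_ ?_
    · simp only [pow_succ' (cs.simple s * cs.simple t), pow_succ (cs.simple t * cs.simple s),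
        mul_assoc]
    · simp [add_assoc]

open Classical in
lemma act_liftable : M.IsLiftable (act cs) := by
  intro s t
  funext p
  obtain ⟨x, e⟩ := p
  rw [act_pow]
  have h1 : (cs.simple s * cs.simple t) ^ M s t = 1 := cs.simple_mul_simple_pow s t
  have h2 : (cs.simple t * cs.simple s) ^ M s t = 1 := cs.simple_mul_simple_pow' s t
  rw [two_mul, Finset.sum_range_add]
  simp only [h1, h2, pow_add, one_mul, mul_one]
  rw [CharTwo.add_self_eq_zero, add_zero]
  rfl

/-- The lifted action. -/
noncomputable def actHom : W →* Function.End (W × ZMod 2) := cs.lift ⟨act cs, act_liftable cs⟩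

open Classical in
lemma actHom_word (ω : List B) (x : W) (e : ZMod 2) :
    actHom cs (cs.wordProd ω) (x, e) =
      (cs.wordProd ω * x * (cs.wordProd ω)⁻¹, e + ((cs.rightInvSeq ω).count x : ℕ)) := by
  induction ω with
  | nil => simp; rfl
  | cons i ω ih =>
    rw [cs.wordProd_cons, map_mul]
    change actHom cs (cs.simple i) (actHom cs (cs.wordProd ω) (x, e)) = _
    rw [ih, actHom, cs.lift_apply_simple (act_liftable cs)]
    simp only [act, CoxeterSystem.rightInvSeq, List.count_cons]
    refine Prod.ext ?_ ?_
    · simp [mul_assoc]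
    · have : (cs.wordProd ω * x * (cs.wordProd ω)⁻¹ = cs.simple i) ↔
          ((cs.wordProd ω)⁻¹ * cs.simple i * cs.wordProd ω = x) := by
        rw [mul_inv_eq_iff_eq_mul, mul_assoc, inv_mul_eq_iff_eq_mul, eq_comm]
      simp only [this, beq_iff_eq]
      split_ifs <;> simp [add_assoc]

lemma mem_ris {ω : List B} (i : B) (h : cs.IsRightDescent (cs.wordProd ω) i) :
    cs.simple i ∈ cs.rightInvSeq ω := by
  classical
  obtain ⟨ω', hr, hw⟩ := cs.exists_isReduced (cs.wordProd ω * cs.simple i)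
  have hw' : cs.wordProd ω = cs.wordProd (ω' ++ [i]) := by
    rw [cs.wordProd_append, ← hw]; simp
  have hn : cs.simple i ∉ cs.rightInvSeq ω' := by
    intro hm
    have := (cs.isRightInversion_of_mem_rightInvSeq hr hm).2
    rw [← hw] at this
    simp only [CoxeterSystem.IsRightDescent] at h
    simp at this
    omega
  have e1 := congrArg Prod.snd (actHom_word cs ω (cs.simple i) 0)
  have e2 : (actHom cs (cs.wordProd ω) (cs.simple i, 0)).2 = 1 := by
    rw [hw', cs.wordProd_append, map_mul]
    change (actHom cs (cs.wordProd ω') (actHom cs (cs.wordProd [i]) (cs.simple i, 0))).2 = 1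
    rw [actHom_word cs [i]]
    simp [actHom_word, List.count_eq_zero_of_not_mem hn]
  rw [e2] at e1
  by_contra hne
  rw [List.count_eq_zero_of_not_mem hne] at e1
  simp at e1

/-- The exchange condition. -/
lemma exchange {ω : List B} (i : B) (h : cs.IsLeftDescent (cs.wordProd ω) i) :
    ∃ j < ω.length, cs.simple i * cs.wordProd ω = cs.wordProd (ω.eraseIdx j) := by
  have h1 : cs.IsRightDescent (cs.wordProd ω.reverse) i := by
    rw [cs.wordProd_reverse, cs.isRightDescent_inv_iff]; exact h
  have h2 := mem_ris cs i h1
  rw [cs.rightInvSeq_reverse, List.mem_reverse, List.mem_iff_getElem] at h2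
  obtain ⟨j, hj, hji⟩ := h2
  refine ⟨j, by simpa using hj, ?_⟩
  rw [← cs.getD_leftInvSeq_mul_wordProd, List.getD_eq_getElem _ _ hj, hji]

/-! ### Descents -/

lemma desc_len {w : W} {s : B} (h : cs.IsLeftDescent w s) :
    cs.length (cs.simple s * w) + 1 = cs.length w := cs.isLeftDescent_iff.1 h

lemma desc_of_lt {w : W} {s : B} {n : ℕ} (h1 : cs.length (cs.simple s * w) ≤ n)
    (h2 : n < cs.length w) : cs.IsLeftDescent w s := lt_of_le_of_lt h1 h2

lemma reduced_cons {w : W} {s : B} (h : cs.IsLeftDescent w s) {ω : List B}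
    (hr : cs.IsReduced ω) (hw : cs.wordProd ω = cs.simple s * w) :
    cs.wordProd (s :: ω) = w ∧ cs.IsReduced (s :: ω) := by
  have h1 : cs.wordProd (s :: ω) = w := by rw [cs.wordProd_cons, hw]; simp
  refine ⟨h1, ?_⟩
  have := desc_len cs h
  have h2 : cs.length (cs.wordProd ω) = ω.length := hr
  simp only [CoxeterSystem.IsReduced, h1, List.length_cons]
  rw [hw] at h2
  omega

/-- Another descent stays a descent. -/
lemma desc_a {w : W} {s t : B} (hst : s ≠ t) (hs : cs.IsLeftDescent w s)
    (ht : cs.IsLeftDescent w t) : cs.IsLeftDescent (cs.simple t * w) s := by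
  obtain ⟨ω, hr, hw⟩ := cs.exists_isReduced (cs.simple s * w)
  obtain ⟨h1, h2⟩ := reduced_cons cs hs hr hw.symm
  have ht' := ht
  rw [← h1] at ht'
  obtain ⟨j, hj, hji⟩ := exchange cs t ht'
  have l1 := desc_len cs hs
  have l2 := desc_len cs ht
  have l3 : cs.length (cs.wordProd ω) = ω.length := hr
  rw [← hw] at l3
  rw [h1] at hji
  cases j with
  | zero =>
    simp only [List.eraseIdx_cons_zero, ← hw] at hji
    exact absurd (simple_inj cs (mul_right_cancel hji)).symm hst
  | succ j =>
    rw [List.eraseIdx_cons_succ, cs.wordProd_cons] at hji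
    have : cs.simple s * (cs.simple t * w) = cs.wordProd (ω.eraseIdx j) := by
      rw [hji]; simp
    have l4 := cs.length_wordProd_le (ω.eraseIdx j)
    simp only [List.length_cons] at hj
    rw [List.length_eraseIdx_of_lt (by omega), ← this] at l4
    exact desc_of_lt cs l4 (by omega)

/-- Two non-commuting descents give a braid. -/
lemma desc_b {w : W} {s t : B} (hst : s ≠ t) (hM : M s t ≠ 2) (hs : cs.IsLeftDescent w s)
    (ht : cs.IsLeftDescent w t) :
    cs.IsLeftDescent (cs.simple t * (cs.simple s * w)) s := by
  have hst' := desc_a cs hst hs ht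
  have hts' := desc_a cs hst.symm ht hs
  obtain ⟨ω, hr, hw⟩ := cs.exists_isReduced (cs.simple s * (cs.simple t * w))
  obtain ⟨h1, h2⟩ := reduced_cons cs hst' hr hw.symm
  obtain ⟨h3, h4⟩ := reduced_cons cs ht h2 h1
  have hs' := hs
  rw [← h3] at hs'
  obtain ⟨j, hj, hji⟩ := exchange cs s hs'
  have l1 := desc_len cs hs
  have l2 := desc_len cs ht
  have l5 := desc_len cs hst'
  have l6 := desc_len cs hts'
  have l3 : cs.length (cs.wordProd ω) = ω.length := hr
  rw [← hw] at l3
  rw [h3] at hji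
  rcases j with _ | _ | j
  · rw [List.eraseIdx_cons_zero, h1] at hji
    exact absurd (simple_inj cs (mul_right_cancel hji)) hst
  · rw [List.eraseIdx_cons_succ, List.eraseIdx_cons_zero, cs.wordProd_cons, ← hw, ← mul_assoc,
      ← mul_assoc] at hji
    have h6 := mul_right_cancel hji
    exfalso
    apply hM
    apply commute_imp cs hst
    nth_rewrite 1 [h6]
    simp
  · rw [List.eraseIdx_cons_succ, List.eraseIdx_cons_succ, cs.wordProd_cons, cs.wordProd_cons]
      at hji
    have : cs.simple s * (cs.simple t * (cs.simple s * w)) = cs.wordProd (ω.eraseIdx j) := by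
      rw [hji]; simp
    have l4 := cs.length_wordProd_le (ω.eraseIdx j)
    simp only [List.length_cons] at hj
    rw [List.length_eraseIdx_of_lt (by omega), ← this] at l4
    exact desc_of_lt cs l4 (by omega)

end Exchange
end CoxCount

namespace CoxCount

/-! ### Bounded sets -/

section Bd

variable {α : Type*}

/-- `A` is finite with at most `n` elements. -/
def Bd (A : Set α) (n : ℕ) : Prop := A.Finite ∧ A.ncard ≤ n

lemma Bd.mono {A X : Set α} {n : ℕ} (h : Bd X n) (hs : A ⊆ X) : Bd A n :=
  ⟨h.1.subset hs, (Set.ncard_le_ncard hs h.1).trans h.2⟩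

lemma Bd.le {A : Set α} {n m : ℕ} (h : Bd A n) (hs : n ≤ m) : Bd A m := ⟨h.1, h.2.trans hs⟩

lemma bd_one_iff {A : Set α} : Bd A 1 ↔ A.Subsingleton := by
  constructor
  · rintro ⟨h1, h2⟩ a ha b hb
    exact (Set.ncard_le_one h1).1 h2 a ha b hb
  · intro h
    exact ⟨h.finite, (Set.ncard_le_one h.finite).2 fun a ha b hb => h ha hb⟩

lemma Bd.union {A X : Set α} {n m : ℕ} (h : Bd A n) (h' : Bd X m) : Bd (A ∪ X) (n + m) :=
  ⟨h.1.union h'.1, (Set.ncard_union_le A X).trans (add_le_add h.2 h'.2)⟩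

lemma Bd.union1 {A X : Set α} {n m k : ℕ} (h : Bd A n) (h' : Bd X m) {z : α} (h1 : z ∈ A)
    (h2 : z ∈ X) (hk : n + m ≤ k + 1) : Bd (A ∪ X) k := by
  refine ⟨h.1.union h'.1, ?_⟩
  have e := Set.ncard_union_add_ncard_inter A X h.1 h'.1
  have : 0 < (A ∩ X).ncard := (Set.ncard_pos (h.1.inter_of_left X)).2 ⟨z, h1, h2⟩
  have := h.2
  have := h'.2
  omega

lemma Bd.union2 {A X : Set α} {n m k : ℕ} (h : Bd A n) (h' : Bd X m) {z y : α} (hne : z ≠ y)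
    (h1 : z ∈ A) (h2 : z ∈ X) (h3 : y ∈ A) (h4 : y ∈ X) (hk : n + m ≤ k + 2) :
    Bd (A ∪ X) k := by
  refine ⟨h.1.union h'.1, ?_⟩
  have e := Set.ncard_union_add_ncard_inter A X h.1 h'.1
  have : 1 < (A ∩ X).ncard :=
    (Set.one_lt_ncard (h.1.inter_of_left X)).2 ⟨z, ⟨h1, h2⟩, y, ⟨h3, h4⟩, hne⟩
  have := h.2
  have := h'.2
  omega

lemma Bd.image {β : Type*} {A : Set α} {n : ℕ} (h : Bd A n) (f : α → β) : Bd (f '' A) n :=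
  ⟨h.1.image f, (Set.ncard_image_le h.1).trans h.2⟩

end Bd

section Descents

variable {B : Type*} {M : CoxeterMatrix B} {W : Type*} [Group W] (cs : CoxeterSystem M W)

/-! ### Size of descent sets -/

lemma size1 (J : Finset B) : ∀ w : W, (∀ x ∈ J, cs.IsLeftDescent w x) → J.card ≤ cs.length w := by
  classical
  induction J using Finset.induction with
  | empty => simp
  | insert p J hp ih =>
    intro w h
    have hpw := h p (Finset.mem_insert_self p J)
    have := ih (cs.simple p * w) (fun x hx => desc_a cs (by rintro rfl; exact hp hx)
      (h x (Finset.mem_insert_of_mem hx)) hpw)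
    have l := desc_len cs hpw
    rw [Finset.card_insert_of_notMem hp]
    omega

lemma stepN [DecidableEq B] {J : Finset B} {w : W} (h : ∀ x ∈ J, cs.IsLeftDescent w x) {p q : B}
    (hp : p ∈ J) (hq : q ∈ J) (hpq : p ≠ q) (hM : M p q ≠ 2) :
    (∀ x ∈ J.erase q, cs.IsLeftDescent (cs.simple q * (cs.simple p * w)) x) ∧
      cs.length (cs.simple q * (cs.simple p * w)) + 2 = cs.length w := by
  have hqp := desc_a cs hpq.symm (h q hq) (h p hp)
  constructor
  · intro x hx
    obtain ⟨hxq, hxJ⟩ := Finset.mem_erase.1 hx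
    by_cases hxp : x = p
    · subst hxp
      exact desc_b cs hpq hM (h x hp) (h q hq)
    · exact desc_a cs hxq (desc_a cs hxp (h x hxJ) (h p hp)) hqp
  · have := desc_len cs hqp
    have := desc_len cs (h p hp)
    omega

lemma size2 {J : Finset B} {w : W} (h : ∀ x ∈ J, cs.IsLeftDescent w x) {p q : B}
    (hp : p ∈ J) (hq : q ∈ J) (hpq : p ≠ q) (hM : M p q ≠ 2) : J.card + 1 ≤ cs.length w := by
  classical
  obtain ⟨h1, h2⟩ := stepN cs h hp hq hpq hM
  have h3 := size1 cs _ _ h1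
  rw [Finset.card_erase_of_mem hq] at h3
  omega

/-- Two disjoint non-commuting pairs. -/
lemma size22 {J : Finset B} {w : W} (h : ∀ x ∈ J, cs.IsLeftDescent w x) {p q r s : B}
    (hp : p ∈ J) (hq : q ∈ J) (hr : r ∈ J) (hs : s ∈ J) (hpq : p ≠ q) (hM : M p q ≠ 2)
    (hrs : r ≠ s) (hM' : M r s ≠ 2) (hrq : r ≠ q) (hsq : s ≠ q) : J.card + 2 ≤ cs.length w := by
  classical
  obtain ⟨h1, h2⟩ := stepN cs h hp hq hpq hM
  have h3 := size2 cs h1 (Finset.mem_erase.2 ⟨hrq, hr⟩) (Finset.mem_erase.2 ⟨hsq, hs⟩) hrs hM'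
  rw [Finset.card_erase_of_mem hq] at h3
  omega

/-- A path `p - q - r` of non-commuting descents. -/
lemma sizeP {J : Finset B} {w : W} (h : ∀ x ∈ J, cs.IsLeftDescent w x) {p q r : B}
    (hp : p ∈ J) (hq : q ∈ J) (hr : r ∈ J) (hpq : p ≠ q) (hM : M p q ≠ 2)
    (hqr : q ≠ r) (hM' : M q r ≠ 2) (hpr : p ≠ r) : J.card + 3 ≤ cs.length w := by
  classical
  obtain ⟨h1, h2⟩ := stepN cs h hp hq hpq hM
  have hr' := h1 r (Finset.mem_erase.2 ⟨hqr.symm, hr⟩)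
  have h4 : ∀ x ∈ J.erase r,
      cs.IsLeftDescent (cs.simple r * (cs.simple q * (cs.simple p * w))) x := by
    intro x hx
    obtain ⟨hxr, hxJ⟩ := Finset.mem_erase.1 hx
    by_cases hxq : x = q
    · subst hxq
      exact desc_b cs hqr hM' (desc_a cs hpq.symm (h x hq) (h p hp))
        (desc_a cs hpr.symm (h r hr) (h p hp))
    · exact desc_a cs hxr (h1 x (Finset.mem_erase.2 ⟨hxq, hxJ⟩)) hr'
  have h3 := size2 cs h4 (Finset.mem_erase.2 ⟨hpr, hp⟩) (Finset.mem_erase.2 ⟨hqr, hq⟩) hpq hM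
  have := desc_len cs hr'
  rw [Finset.card_erase_of_mem hr] at h3
  omega

lemma tri_aux (n : ℕ) : ∀ (v : W) (a b c : B), cs.length v = n → a ≠ b → b ≠ c → a ≠ c →
    M a b ≠ 2 → M b c ≠ 2 → M a c ≠ 2 → cs.IsLeftDescent v a → cs.IsLeftDescent v b →
    cs.IsLeftDescent (cs.simple a * v) c → False := by
  induction n with
  | zero =>
    intro v a b c hv _ _ _ _ _ _ ha
    have := desc_len cs ha
    omega
  | succ n ih =>
    intro v a b c hv hab hbc hac mab mbc mac ha hb hc
    have hb' := desc_a cs hab.symm hb ha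
    have := desc_len cs ha
    exact ih (cs.simple a * v) b c a (by omega) hbc hac.symm hab.symm mbc
      (by rwa [M.symmetric]) (by rwa [M.symmetric]) hb' hc (desc_b cs hab mab ha hb)

/-- There is no triangle of pairwise non-commuting descents. -/
lemma no_tri {w : W} {a b c : B} (hab : a ≠ b) (hbc : b ≠ c) (hac : a ≠ c)
    (mab : M a b ≠ 2) (mbc : M b c ≠ 2) (mac : M a c ≠ 2) (ha : cs.IsLeftDescent w a)
    (hb : cs.IsLeftDescent w b) (hc : cs.IsLeftDescent w c) : False :=
  tri_aux cs _ w a b c rfl hab hbc hac mab mbc mac ha hb (desc_a cs hac.symm hc ha)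

/-! ### Commutation classes -/

/-- Reduced words of `w`. -/
abbrev RW (w : W) : Type _ := {ω : List B // cs.wordProd ω = w ∧ cs.IsReduced ω}

/-- Commutation classes of reduced words of `w`. -/
abbrev Cls (w : W) : Type _ :=
  Quot (fun u v : RW cs w => SwapStep (fun a b => M a b = 2) u.1 v.1)

/-- Commutation classes with a word starting with `s`. -/
def A (w : W) (s : B) : Set (Cls cs w) :=
  {c | ∃ (ω : List B) (h : cs.wordProd (s :: ω) = w ∧ cs.IsReduced (s :: ω)),
    c = Quot.mk _ ⟨s :: ω, h⟩}

/-- `w` has at most `n` classes. -/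
def CB (w : W) (n : ℕ) : Prop := Bd (Set.univ : Set (Cls cs w)) n

/-- Prepending a letter. -/
def pre {w : W} {s : B} (h : cs.IsLeftDescent w s) : Cls cs (cs.simple s * w) → Cls cs w :=
  Quot.map (fun ω => ⟨s :: ω.1, reduced_cons cs h ω.2.2 ω.2.1⟩) (by
    rintro ⟨u, hu⟩ ⟨v, hv⟩ ⟨x, y, a, b, hab, h1, h2⟩
    exact ⟨s :: x, y, a, b, hab, by simp_all, by simp_all⟩)

lemma reduced_tail {s : B} {ω : List B} (hr : cs.IsReduced (s :: ω)) : cs.IsReduced ω := by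
  simpa using hr.drop 1

lemma desc_head {s : B} {ω : List B} (hr : cs.IsReduced (s :: ω)) :
    cs.IsLeftDescent (cs.wordProd (s :: ω)) s := by
  have h1 : cs.length _ = _ := hr
  have h2 : cs.length _ = _ := reduced_tail cs hr
  have h3 : cs.simple s * cs.wordProd (s :: ω) = cs.wordProd ω := by
    rw [cs.wordProd_cons]; simp
  unfold CoxeterSystem.IsLeftDescent
  rw [h3, h1, h2]
  simp

lemma A_eq {w : W} {s : B} (h : cs.IsLeftDescent w s) : A cs w s = pre cs h '' Set.univ := by
  ext c
  constructor
  · rintro ⟨ω, hω, rfl⟩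
    refine ⟨Quot.mk _ ⟨ω, ?_, reduced_tail cs hω.2⟩, trivial, rfl⟩
    rw [← hω.1, cs.wordProd_cons]; simp
  · rintro ⟨c, -, rfl⟩
    induction c using Quot.ind with
    | mk ω => exact ⟨ω.1, reduced_cons cs h ω.2.2 ω.2.1, rfl⟩

lemma A_bd {w : W} {s : B} {n : ℕ} (h : cs.IsLeftDescent w s) (hn : CB cs (cs.simple s * w) n) :
    Bd (A cs w s) n := by
  rw [A_eq cs h]
  exact hn.image _

lemma cover {w : W} (hw : 0 < cs.length w) (c : Cls cs w) :
    ∃ s, cs.IsLeftDescent w s ∧ c ∈ A cs w s := by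
  induction c using Quot.ind with
  | mk ω =>
    obtain ⟨ω, h1, h2⟩ := ω
    cases ω with
    | nil => rw [← h1] at hw; simp at hw
    | cons s ω =>
      refine ⟨s, ?_, ω, ⟨h1, h2⟩, rfl⟩
      have := desc_head cs h2
      rwa [h1] at this

lemma CB_of {w : W} (hw : 0 < cs.length w) {X : Set (Cls cs w)} {n : ℕ} (hX : Bd X n)
    (h : ∀ s, cs.IsLeftDescent w s → A cs w s ⊆ X) : CB cs w n :=
  hX.mono fun c _ => by
    obtain ⟨s, h1, h2⟩ := cover cs hw c
    exact h s h1 h2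

lemma common (J : Finset B) : ∀ w : W, (∀ x ∈ J, cs.IsLeftDescent w x) →
    (∀ x ∈ J, ∀ y ∈ J, x ≠ y → M x y = 2) → ∃ z, ∀ s ∈ J, z ∈ A cs w s := by
  classical
  induction J using Finset.induction with
  | empty =>
    intro w _ _
    obtain ⟨ω, h1, h2⟩ := cs.exists_isReduced w
    exact ⟨Quot.mk _ ⟨ω, h2.symm, h1⟩, by simp⟩
  | insert p J hp ih =>
    intro w h hc
    have hpw := h p (Finset.mem_insert_self p J)
    obtain ⟨z, hz⟩ := ih (cs.simple p * w) (fun x hx => desc_a cs (by rintro rfl; exact hp hx)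
      (h x (Finset.mem_insert_of_mem hx)) hpw)
      (fun x hx y hy => hc x (Finset.mem_insert_of_mem hx) y (Finset.mem_insert_of_mem hy))
    refine ⟨pre cs hpw z, ?_⟩
    intro t ht
    rcases Finset.mem_insert.1 ht with rfl | htJ
    · rw [A_eq cs hpw]
      exact ⟨z, trivial, rfl⟩
    · obtain ⟨ω, hω, rfl⟩ := hz t htJ
      have hpt : p ≠ t := by rintro rfl; exact hp htJ
      have hM : M p t = 2 := hc p (Finset.mem_insert_self p J) t ht hpt
      have hcomm : cs.simple p * cs.simple t = cs.simple t * cs.simple p := by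
        have h1 := cs.simple_mul_simple_pow p t
        rw [hM, pow_two] at h1
        have := eq_inv_of_mul_eq_one_left h1
        simpa using this
      have hr := reduced_cons cs hpw hω.2 hω.1
      have hw' : cs.wordProd (t :: p :: ω) = w := by
        rw [← hr.1]
        simp only [cs.wordProd_cons, ← mul_assoc, hcomm]
      have hred : cs.IsReduced (t :: p :: ω) := by
        have h2 : cs.length _ = _ := hr.2
        rw [hr.1] at h2
        unfold CoxeterSystem.IsReduced
        rw [hw', h2]
        rfl
      refine ⟨p :: ω, ⟨hw', hred⟩, ?_⟩
      exact Quot.sound ⟨[], ω, p, t, hM, rfl, rfl⟩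

lemma common2 {w : W} {s t : B} (hs : cs.IsLeftDescent w s) (ht : cs.IsLeftDescent w t)
    (h : M s t = 2) : ∃ z, z ∈ A cs w s ∧ z ∈ A cs w t := by
  classical
  obtain ⟨z, hz⟩ := common cs {s, t} w (by simp [hs, ht]) (by
    have := M.symmetric s t
    simp_all)
  exact ⟨z, hz s (by simp), hz t (by simp)⟩

lemma common3 {w : W} {s t u : B} (hs : cs.IsLeftDescent w s) (ht : cs.IsLeftDescent w t)
    (hu : cs.IsLeftDescent w u) (h : M s t = 2) (h' : M s u = 2) (h'' : M t u = 2) :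
    ∃ z, z ∈ A cs w s ∧ z ∈ A cs w t ∧ z ∈ A cs w u := by
  classical
  obtain ⟨z, hz⟩ := common cs {s, t, u} w (by simp [hs, ht, hu]) (by
    have := M.symmetric s t
    have := M.symmetric s u
    have := M.symmetric t u
    simp_all)
  exact ⟨z, hz s (by simp), hz t (by simp), hz u (by simp)⟩

open Classical in
lemma disj {w : W} {s t : B} (hst : s ≠ t) (h : M s t ≠ 2) {y z : Cls cs w}
    (hy : y ∈ A cs w s) (hz : z ∈ A cs w t) : y ≠ z := by
  let f : Cls cs w → Option B :=
    Quot.lift (fun ω => (ω.1.filter (fun b => b = s ∨ b = t)).head?) (by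
      rintro ⟨u, hu⟩ ⟨v, hv⟩ ⟨x, y, a, b, hab, rfl, rfl⟩
      have hs : M b a = 2 := by rw [M.symmetric]; exact hab
      have hts : M t s ≠ 2 := by rw [M.symmetric]; exact h
      have e : List.filter (fun b => decide (b = s ∨ b = t)) (a :: b :: y) =
          List.filter (fun b => decide (b = s ∨ b = t)) (b :: a :: y) := by
        by_cases h1 : a = s ∨ a = t <;> by_cases h2 : b = s ∨ b = t
        · rcases h1 with rfl | rfl <;> rcases h2 with rfl | rfl <;> simp_all
        · simp [List.filter_cons, h1, h2]
        · simp [List.filter_cons, h1, h2]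
        · simp [List.filter_cons, h1, h2]
      simp only [List.filter_append, e])
  rintro rfl
  obtain ⟨u, hu, rfl⟩ := hy
  obtain ⟨v, hv, e⟩ := hz
  have := congrArg f e
  simp [f] at this
  exact hst this

/-- A commuting set of descents of size at least `ℓ - 1` forces a single class. -/
lemma L1 (n : ℕ) : ∀ (w : W) (J : Finset B), cs.length w = n → (∀ x ∈ J, cs.IsLeftDescent w x) →
    (∀ x ∈ J, ∀ y ∈ J, x ≠ y → M x y = 2) → n ≤ J.card + 1 → CB cs w 1 := by
  classical
  induction n with
  | zero =>
    intro w J hw _ _ _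
    refine bd_one_iff.2 ?_
    have hnil : ∀ ω : RW cs w, ω.1 = [] := by
      rintro ⟨ω, h1, h2⟩
      have h3 : cs.length _ = _ := h2
      rw [h1, hw] at h3
      exact List.eq_nil_of_length_eq_zero h3.symm
    intro c _ d _
    induction c using Quot.ind with
    | mk u =>
      induction d using Quot.ind with
      | mk v => exact congrArg _ (Subtype.ext ((hnil u).trans (hnil v).symm))
  | succ n ih =>
    intro w J hw hJ hc hn
    have sub : ∀ p, cs.IsLeftDescent w p → (A cs w p).Subsingleton := by
      intro p hp
      refine bd_one_iff.1 (A_bd cs hp (ih _ (J.erase p) ?_ ?_ ?_ ?_))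
      · have := desc_len cs hp
        omega
      · intro x hx
        obtain ⟨h1, h2⟩ := Finset.mem_erase.1 hx
        exact desc_a cs h1 (hJ x h2) hp
      · intro x hx y hy
        exact hc x (Finset.mem_of_mem_erase hx) y (Finset.mem_of_mem_erase hy)
      · have := Finset.pred_card_le_card_erase (s := J) (a := p)
        omega
    refine bd_one_iff.2 ?_
    intro c _ d _
    obtain ⟨p, hp, hcp⟩ := cover cs (by omega) c
    obtain ⟨q, hq, hdq⟩ := cover cs (by omega) d
    by_cases hpq : p = q
    · subst hpq
      exact sub p hp hcp hdq
    by_cases hM : M p q = 2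
    · obtain ⟨z, h1, h2⟩ := common2 cs hp hq hM
      rw [sub p hp hcp h1, sub q hq h2 hdq]
    · exfalso
      have h1 : J.card + 1 ≤ (insert p (insert q J)).card := by
        by_cases hpJ : p ∈ J
        · by_cases hqJ : q ∈ J
          · exact absurd (hc p hpJ q hqJ hpq) hM
          · rw [← Finset.card_insert_of_notMem hqJ]
            exact Finset.card_le_card (Finset.subset_insert _ _)
        · rw [← Finset.card_insert_of_notMem hpJ]
          exact Finset.card_le_card (Finset.insert_subset_insert _ (Finset.subset_insert _ _))
      have h2 := size2 cs (J := insert p (insert q J)) (w := w) (by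
        intro x hx
        simp only [Finset.mem_insert] at hx
        rcases hx with rfl | rfl | hx
        · exact hp
        · exact hq
        · exact hJ x hx) (p := p) (q := q) (by simp) (by simp) hpq hM
      omega

end Descents
end CoxCount

namespace CoxCount

section Upper

variable {B : Type*} {M : CoxeterMatrix B} {W : Type*} [Group W] (cs : CoxeterSystem M W)

/-! ### Small lengths -/

lemma comm (cs : CoxeterSystem M W) {s t : B} (h : M s t = 2) :
    cs.simple s * cs.simple t = cs.simple t * cs.simple s := by
  have h1 := cs.simple_mul_simple_pow s t
  rw [h, pow_two] at h1
  have h2 : cs.simple s * cs.simple t = (cs.simple s * cs.simple t)⁻¹ := eq_inv_of_mul_eq_one_left h1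
  rw [h2]
  simp

lemma comm' (cs : CoxeterSystem M W) {s t : B} (h : M s t = 2) (w : W) :
    cs.simple s * (cs.simple t * w) = cs.simple t * (cs.simple s * w) := by
  rw [← mul_assoc, comm cs h, mul_assoc]

lemma solve {s : B} {v x : W} (h : cs.simple s * v = x) : v = cs.simple s * x := by
  rw [← h]; simp

lemma Msymm {s t : B} {n : ℕ} (h : M s t = n) : M t s = n := by rw [M.symmetric]; exact h

lemma Msymm' {s t : B} (h : M s t ≠ 2) : M t s ≠ 2 := by rw [M.symmetric]; exact h

lemma ne_of_three {s t : B} (h : M s t = 3) : s ≠ t := by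
  rintro rfl
  rw [M.diagonal] at h
  omega

lemma ex_desc {w : W} (h : 0 < cs.length w) : ∃ s, cs.IsLeftDescent w s := by
  apply cs.exists_leftDescent_of_ne_one
  rintro rfl
  simp at h

lemma len1 {x q : B} (h : cs.IsLeftDescent (cs.simple x) q) : q = x := by
  have h1 := desc_len cs h
  rw [cs.length_simple] at h1
  have h2 : cs.length (cs.simple q * cs.simple x) = 0 := by omega
  rw [cs.length_eq_zero_iff] at h2
  have h3 := solve cs h2
  apply simple_inj cs
  rw [h3]; simp

lemma len2 {p x : B} (h : p ≠ x) : cs.length (cs.simple p * cs.simple x) = 2 := by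
  by_contra hne
  have h1 := cs.length_mul_le (cs.simple p) (cs.simple x)
  have h2 := cs.length_mul_mod_two (cs.simple p) (cs.simple x)
  simp only [cs.length_simple] at h1 h2
  have h3 : cs.length (cs.simple p * cs.simple x) = 0 := by omega
  rw [cs.length_eq_zero_iff] at h3
  apply h
  apply simple_inj cs
  rw [solve cs h3]
  simp

lemma desc2 {p x : B} (h : p ≠ x) : cs.IsLeftDescent (cs.simple p * cs.simple x) p := by
  unfold CoxeterSystem.IsLeftDescent
  rw [len2 cs h]
  simp

lemma uniq {p x q : B} (hM : M p x = 3) (hd : cs.IsLeftDescent (cs.simple p * cs.simple x) q) :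
    q = p := by
  classical
  by_contra hqp
  have hne := ne_of_three hM
  have hp := desc2 cs hne
  by_cases h : M p q = 2
  · have h1 := desc_a cs hqp hd hp
    have h2 : q = x := by
      apply len1 cs
      simpa using h1
    subst h2
    omega
  · have h1 := size2 cs (J := {p, q}) (w := cs.simple p * cs.simple x)
      (by simp [hp, hd]) (p := p) (q := q) (by simp) (by simp) (Ne.symm hqp) h
    rw [Finset.card_pair (Ne.symm hqp), len2 cs hne] at h1
    omega

lemma uniq2 {p x q y : B} (hM : M p x = 3) (hM' : M q y = 3)
    (h : cs.simple p * cs.simple x = cs.simple q * cs.simple y) : p = q ∧ x = y := by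
  have h1 : cs.IsLeftDescent (cs.simple p * cs.simple x) q := by
    rw [h]; exact desc2 cs (ne_of_three hM')
  have h2 := uniq cs hM h1
  subst h2
  exact ⟨rfl, simple_inj cs (mul_left_cancel h)⟩

lemma ex1 {w : W} (h : cs.length w = 1) {s : B} (hs : cs.IsLeftDescent w s) : w = cs.simple s := by
  obtain ⟨i, rfl⟩ := cs.length_eq_one_iff.1 h
  rw [len1 cs hs]

lemma L1_1 {w : W} (hn : cs.length w ≤ 2) : CB cs w 1 := by
  by_cases h : 0 < cs.length w
  · obtain ⟨s, hs⟩ := ex_desc cs h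
    exact L1 cs _ w {s} rfl (by simpa using hs) (by simp) (by simpa using hn)
  · exact L1 cs _ w ∅ rfl (by simp) (by simp) (by omega)

lemma L1_2 {w : W} {s t : B} (hs : cs.IsLeftDescent w s) (ht : cs.IsLeftDescent w t)
    (hst : s ≠ t) (h : M s t = 2) (hn : cs.length w ≤ 3) : CB cs w 1 := by
  classical
  refine L1 cs _ w {s, t} rfl (by simp [hs, ht]) ?_ (by rw [Finset.card_pair hst]; omega)
  have := Msymm h
  simp_all

lemma L1_3 {w : W} {s t u : B} (hs : cs.IsLeftDescent w s) (ht : cs.IsLeftDescent w t)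
    (hu : cs.IsLeftDescent w u) (hst : s ≠ t) (hsu : s ≠ u) (htu : t ≠ u)
    (h : M s t = 2) (h' : M s u = 2) (h'' : M t u = 2) (hn : cs.length w ≤ 4) : CB cs w 1 := by
  classical
  refine L1 cs _ w {s, t, u} rfl (by simp [hs, ht, hu]) ?_
    (by rw [Finset.card_eq_three.2 ⟨s, t, u, hst, hsu, htu, rfl⟩]; omega)
  have := Msymm h
  have := Msymm h'
  have := Msymm h''
  simp_all

lemma L1_4 {w : W} {s t u v : B} (hs : cs.IsLeftDescent w s) (ht : cs.IsLeftDescent w t)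
    (hu : cs.IsLeftDescent w u) (hv : cs.IsLeftDescent w v)
    (hst : s ≠ t) (hsu : s ≠ u) (htu : t ≠ u) (hsv : s ≠ v) (htv : t ≠ v) (huv : u ≠ v)
    (h1 : M s t = 2) (h2 : M s u = 2) (h3 : M t u = 2) (h4 : M s v = 2) (h5 : M t v = 2)
    (h6 : M u v = 2) (hn : cs.length w ≤ 5) : CB cs w 1 := by
  classical
  refine L1 cs _ w {s, t, u, v} rfl (by simp [hs, ht, hu, hv]) ?_
    (by
      have : Finset.card {s, t, u, v} = 4 := by simp [*]
      omega)
  have := Msymm h1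
  have := Msymm h2
  have := Msymm h3
  have := Msymm h4
  have := Msymm h5
  have := Msymm h6
  simp_all

lemma B3 {v : W} (hl : cs.length v = 3) {s t : B} (hst : s ≠ t) (hM : M s t ≠ 2)
    (hs : cs.IsLeftDescent v s) (ht : cs.IsLeftDescent v t) :
    M s t = 3 ∧ v = cs.simple s * (cs.simple t * cs.simple s) := by
  have key : ∀ a b : B, a ≠ b → M a b ≠ 2 → cs.IsLeftDescent v a → cs.IsLeftDescent v b →
      v = cs.simple a * (cs.simple b * cs.simple a) := by
    intro a b hab hM ha hb
    have h1 := desc_b cs hab hM ha hb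
    have h2 := desc_len cs ha
    have h3 := desc_len cs (desc_a cs hab.symm hb ha)
    exact solve cs (solve cs (ex1 cs (by omega) h1))
  have h1 := key s t hst hM hs ht
  have h2 := key t s hst.symm (Msymm' hM) ht hs
  refine ⟨braid_imp cs hst ?_, h1⟩
  rw [mul_assoc, mul_assoc, ← h1, ← h2]

/-- Noncommuting pairs of descents bound the number of other descents. -/
lemma T3 {v : W} (hl : cs.length v = 3) {u : B} (hu : cs.IsLeftDescent v u) (hC : ¬ CB cs v 1) :
    ∃ p, M u p = 3 ∧ v = cs.simple u * (cs.simple p * cs.simple u) ∧ cs.IsLeftDescent v p := by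
  by_cases h : ∀ x, cs.IsLeftDescent v x → x = u
  · exfalso
    apply hC
    have h1 := desc_len cs hu
    refine CB_of cs (by omega) (A_bd cs hu (L1_1 cs (by omega))) ?_
    intro x hx
    rw [h x hx]
  · push Not at h
    obtain ⟨p, hp, hpu⟩ := h
    by_cases hM : M u p = 2
    · exact absurd (L1_2 cs hu hp hpu.symm hM (by omega)) hC
    · obtain ⟨h1, h2⟩ := B3 cs hl hpu.symm hM hu hp
      exact ⟨p, h1, h2, hp⟩

lemma sz3 {w : W} {s t u : B} (hs : cs.IsLeftDescent w s) (ht : cs.IsLeftDescent w t)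
    (hu : cs.IsLeftDescent w u) (hst : s ≠ t) (hsu : s ≠ u) (htu : t ≠ u) (hM : M s t ≠ 2) :
    4 ≤ cs.length w := by
  classical
  have := size2 cs (J := {s, t, u}) (w := w) (by simp [hs, ht, hu]) (p := s) (q := t)
    (by simp) (by simp) hst hM
  rwa [Finset.card_eq_three.2 ⟨s, t, u, hst, hsu, htu, rfl⟩] at this

lemma szP3 {w : W} {s t u : B} (hs : cs.IsLeftDescent w s) (ht : cs.IsLeftDescent w t)
    (hu : cs.IsLeftDescent w u) (hst : s ≠ t) (hsu : s ≠ u) (htu : t ≠ u) (hM : M s t ≠ 2)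
    (hl : cs.length w ≤ 5) : M s u = 2 ∧ M t u = 2 := by
  classical
  have hc := Finset.card_eq_three.2 ⟨s, t, u, hst, hsu, htu, rfl⟩
  constructor
  · by_contra h
    have := sizeP cs (J := {s, t, u}) (w := w) (by simp [hs, ht, hu]) (p := t) (q := s) (r := u)
      (by simp) (by simp) (by simp) hst.symm (Msymm' hM) hsu h htu
    omega
  · by_contra h
    have := sizeP cs (J := {s, t, u}) (w := w) (by simp [hs, ht, hu]) (p := s) (q := t) (r := u)
      (by simp) (by simp) (by simp) hst hM htu h hsu
    omega

lemma sz4 {w : W} {s t u v : B} (hs : cs.IsLeftDescent w s) (ht : cs.IsLeftDescent w t)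
    (hu : cs.IsLeftDescent w u) (hv : cs.IsLeftDescent w v)
    (hst : s ≠ t) (hsu : s ≠ u) (htu : t ≠ u) (hsv : s ≠ v) (htv : t ≠ v) (huv : u ≠ v)
    (hM : M s t ≠ 2) : 5 ≤ cs.length w ∧ (cs.length w ≤ 5 → M u v = 2) ∧
    (cs.length w ≤ 6 → M s u = 2 ∧ M t u = 2) := by
  classical
  have hc : Finset.card {s, t, u, v} = 4 := by simp [*]
  have hJ : ∀ x ∈ ({s, t, u, v} : Finset B), cs.IsLeftDescent w x := by simp [hs, ht, hu, hv]
  refine ⟨?_, ?_, ?_⟩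
  · have := size2 cs hJ (p := s) (q := t) (by simp) (by simp) hst hM
    omega
  · intro hl
    by_contra h
    have := size22 cs hJ (p := s) (q := t) (r := u) (s := v) (by simp) (by simp) (by simp)
      (by simp) hst hM huv h htu.symm htv.symm
    omega
  · intro hl
    constructor
    · by_contra h
      have := sizeP cs hJ (p := t) (q := s) (r := u)
        (by simp) (by simp) (by simp) hst.symm (Msymm' hM) hsu h htu
      omega
    · by_contra h
      have := sizeP cs hJ (p := s) (q := t) (r := u)
        (by simp) (by simp) (by simp) hst hM htu h hsu
      omega

lemma sz5 {w : W} {s t u v a : B} (hs : cs.IsLeftDescent w s) (ht : cs.IsLeftDescent w t)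
    (hu : cs.IsLeftDescent w u) (hv : cs.IsLeftDescent w v) (ha : cs.IsLeftDescent w a)
    (hst : s ≠ t) (hsu : s ≠ u) (htu : t ≠ u) (hsv : s ≠ v) (htv : t ≠ v) (huv : u ≠ v)
    (hsa : s ≠ a) (hta : t ≠ a) (hua : u ≠ a) (hva : v ≠ a)
    (hM : M s t ≠ 2) : 6 ≤ cs.length w ∧ (cs.length w ≤ 6 → M u v = 2) := by
  classical
  have hc : Finset.card {s, t, u, v, a} = 5 := by simp [*]
  have hJ : ∀ x ∈ ({s, t, u, v, a} : Finset B), cs.IsLeftDescent w x := by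
    simp [hs, ht, hu, hv, ha]
  refine ⟨?_, ?_⟩
  · have := size2 cs hJ (p := s) (q := t) (by simp) (by simp) hst hM
    omega
  · intro hl
    by_contra h
    have := size22 cs hJ (p := s) (q := t) (r := u) (s := v) (by simp) (by simp) (by simp)
      (by simp) hst hM huv h htu.symm htv.symm
    omega

lemma sz6 {w : W} {s t u v a b : B} (hs : cs.IsLeftDescent w s) (ht : cs.IsLeftDescent w t)
    (hu : cs.IsLeftDescent w u) (hv : cs.IsLeftDescent w v) (ha : cs.IsLeftDescent w a)
    (hb : cs.IsLeftDescent w b)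
    (hst : s ≠ t) (hsu : s ≠ u) (htu : t ≠ u) (hsv : s ≠ v) (htv : t ≠ v) (huv : u ≠ v)
    (hsa : s ≠ a) (hta : t ≠ a) (hua : u ≠ a) (hva : v ≠ a)
    (hsb : s ≠ b) (htb : t ≠ b) (hub : u ≠ b) (hvb : v ≠ b) (hab : a ≠ b)
    (hM : M s t ≠ 2) : 7 ≤ cs.length w := by
  classical
  have hc : Finset.card {s, t, u, v, a, b} = 6 := by simp [*]
  have hJ : ∀ x ∈ ({s, t, u, v, a, b} : Finset B), cs.IsLeftDescent w x := by
    simp [hs, ht, hu, hv, ha, hb]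
  have := size2 cs hJ (p := s) (q := t) (by simp) (by simp) hst hM
  omega

lemma CB3 {v : W} (hl : cs.length v = 3) : CB cs v 2 := by
  by_contra hC
  obtain ⟨u, hu⟩ := ex_desc cs (w := v) (by omega)
  obtain ⟨p, hM, hv, hp⟩ := T3 cs hl hu (fun h => hC (h.le (by norm_num)))
  apply hC
  have h1 := desc_len cs hu
  have h2 := desc_len cs hp
  refine CB_of cs (by omega) ((A_bd cs hu (L1_1 cs (by omega))).union
    (A_bd cs hp (L1_1 cs (by omega)))) ?_
  intro x hx
  by_cases hxu : x = u
  · subst hxu; exact Set.subset_union_left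
  by_cases hxp : x = p
  · subst hxp; exact Set.subset_union_right
  have := sz3 cs hu hp hx (ne_of_three hM) (Ne.symm hxu) (Ne.symm hxp) (by omega)
  omega

lemma sub_of {α : Type*} {A X : Set α} (h : Bd A 1) {z : α} (h1 : z ∈ A) (h2 : z ∈ X) : A ⊆ X := by
  intro y hy
  rw [bd_one_iff.1 h hy h1]
  exact h2

end Upper

end CoxCount

namespace CoxCount

section Upper2

variable {B : Type*} {M : CoxeterMatrix B} {W : Type*} [Group W] (cs : CoxeterSystem M W)

lemma not_desc {w : W} {s : B} (h : cs.IsLeftDescent w s) :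
    ¬ cs.IsLeftDescent (cs.simple s * w) s := by
  intro h'
  have h1 := desc_len cs h
  have h2 := desc_len cs h'
  simp at h2
  omega

lemma braid3 (cs : CoxeterSystem M W) {s t : B} (h : M s t = 3) (w : W) :
    cs.simple s * (cs.simple t * (cs.simple s * w)) =
      cs.simple t * (cs.simple s * (cs.simple t * w)) := by
  have h1 := cs.simple_mul_simple_pow s t
  rw [h] at h1
  have h2 : (cs.simple s * cs.simple t * cs.simple s) * (cs.simple t * cs.simple s * cs.simple t)
      = 1 := by
    rw [← h1]; simp only [pow_succ, pow_zero, one_mul, mul_assoc]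
  have h3 : cs.simple s * cs.simple t * cs.simple s =
      cs.simple t * cs.simple s * cs.simple t := by
    rw [eq_inv_of_mul_eq_one_left h2]
    simp [mul_assoc]
  simp only [← mul_assoc]
  rw [h3]

lemma len_le2 (a b : B) : cs.length (cs.simple a * cs.simple b) ≤ 2 := by
  have := cs.length_wordProd_le [a, b]
  simpa [cs.wordProd_cons] using this

lemma len_le3 (a b c : B) : cs.length (cs.simple a * (cs.simple b * cs.simple c)) ≤ 3 := by
  have := cs.length_wordProd_le [a, b, c]
  simpa [cs.wordProd_cons] using this

/-- If `A_s` is a singleton, it is contained in `A_t` for every commuting descent `t`. -/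
lemma absorb {w : W} {s t : B} (hs : cs.IsLeftDescent w s) (ht : cs.IsLeftDescent w t)
    (h : M s t = 2) (hC : CB cs (cs.simple s * w) 1) : A cs w s ⊆ A cs w t := by
  obtain ⟨z, h1, h2⟩ := common2 cs hs ht h
  exact sub_of (A_bd cs hs hC) h1 h2

lemma CB_1 {w : W} {s : B} (hs : cs.IsLeftDescent w s) {n : ℕ}
    (h : ∀ x, cs.IsLeftDescent w x → x = s) (hC : CB cs (cs.simple s * w) n) : CB cs w n := by
  have h1 := desc_len cs hs
  refine CB_of cs (by omega) (A_bd cs hs hC) ?_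
  intro x hx
  rw [h x hx]

lemma CB_2 {w : W} {s t : B} (hs : cs.IsLeftDescent w s)
    (h : ∀ x, cs.IsLeftDescent w x → x = s ∨ x = t) {n : ℕ} (hC : Bd (A cs w s ∪ A cs w t) n) :
    CB cs w n := by
  have h1 := desc_len cs hs
  refine CB_of cs (by omega) hC ?_
  intro x hx
  rcases h x hx with rfl | rfl
  · exact Set.subset_union_left
  · exact Set.subset_union_right

/-! ### Length four -/

lemma CB4n {w : W} (hl : cs.length w = 4) {s t : B} (hst : s ≠ t) (hM : M s t ≠ 2)
    (hs : cs.IsLeftDescent w s) (ht : cs.IsLeftDescent w t) : CB cs (cs.simple s * w) 1 := by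
  by_contra hC
  have h1 := desc_len cs hs
  have ht' := desc_a cs hst.symm ht hs
  obtain ⟨p, h2, h3, h4⟩ := T3 cs (by omega) ht' hC
  have h5 := desc_b cs hst hM hs ht
  rw [h3] at h5
  simp only [cs.simple_mul_simple_cancel_left] at h5
  have := uniq cs (Msymm h2) h5
  subst this
  exact not_desc cs hs h4

lemma CB4 {w : W} (hl : cs.length w = 4) : CB cs w 2 := by
  by_cases hN : ∃ s t, s ≠ t ∧ M s t ≠ 2 ∧ cs.IsLeftDescent w s ∧ cs.IsLeftDescent w t
  · obtain ⟨s, t, hst, hM, hs, ht⟩ := hN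
    have c1 := CB4n cs hl hst hM hs ht
    have c2 := CB4n cs hl hst.symm (Msymm' hM) ht hs
    by_cases h : ∀ x, cs.IsLeftDescent w x → x = s ∨ x = t
    · exact CB_2 cs hs h ((A_bd cs hs c1).union (A_bd cs ht c2))
    push Not at h
    obtain ⟨u, hu, hus, hut⟩ := h
    obtain ⟨m1, m2⟩ := szP3 cs hs ht hu hst hus.symm hut.symm hM (by omega)
    have hl' := desc_len cs hu
    refine CB_of cs (by omega) (A_bd cs hu (CB3 cs (by omega))) ?_
    intro x hx
    by_cases hxs : x = s
    · subst hxs; exact absorb cs hs hu m1 c1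
    by_cases hxt : x = t
    · subst hxt; exact absorb cs ht hu m2 c2
    by_cases hxu : x = u
    · subst hxu; exact subset_rfl
    have := sz4 cs hs ht hu hx hst hus.symm hut.symm (Ne.symm hxs) (Ne.symm hxt) (Ne.symm hxu) hM
    omega
  · push Not at hN
    obtain ⟨s, hs⟩ := ex_desc cs (w := w) (by omega)
    have ls := desc_len cs hs
    by_cases h : ∀ x, cs.IsLeftDescent w x → x = s
    · exact CB_1 cs hs h (CB3 cs (by omega))
    push Not at h
    obtain ⟨t, ht, hts⟩ := h
    have lt := desc_len cs ht
    have hc : ∀ a b, a ≠ b → cs.IsLeftDescent w a → cs.IsLeftDescent w b → M a b = 2 := by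
      intro a b hab ha hb
      by_contra hM
      exact hN a b hab hM ha hb
    have hM := hc s t hts.symm hs ht
    by_cases h : ∀ x, cs.IsLeftDescent w x → x = s ∨ x = t
    · by_cases c1 : CB cs (cs.simple s * w) 1
      · refine CB_2 cs hs h ((A_bd cs ht (CB3 cs (by omega))).mono ?_)
        exact Set.union_subset (absorb cs hs ht hM c1) subset_rfl
      by_cases c2 : CB cs (cs.simple t * w) 1
      · refine CB_2 cs hs h ((A_bd cs hs (CB3 cs (by omega))).mono ?_)
        exact Set.union_subset subset_rfl (absorb cs ht hs (Msymm hM) c2)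
      exfalso
      obtain ⟨p, p1, p2, -⟩ := T3 cs (by omega) (desc_a cs hts ht hs) c1
      obtain ⟨q, q1, q2, -⟩ := T3 cs (by omega) (desc_a cs hts.symm hs ht) c2
      have e := comm' cs hM w
      rw [p2, q2] at e
      simp only [cs.simple_mul_simple_cancel_left] at e
      exact hts (uniq2 cs (Msymm q1) (Msymm p1) e).2.symm
    push Not at h
    obtain ⟨u, hu, hus, hut⟩ := h
    exact (L1_3 cs hs ht hu hts.symm hus.symm hut.symm hM (hc _ _ hus.symm hs hu)
      (hc _ _ hut.symm ht hu) (by omega)).le (by norm_num)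

lemma E4 {v : W} (hl : cs.length v = 4) {t u : B} (htu : t ≠ u) (hM : M t u = 2)
    (ht : cs.IsLeftDescent v t) (hu : cs.IsLeftDescent v u) (hC : ¬ CB cs v 1) :
    ∃ p x, (x = t ∨ x = u) ∧ M p x = 3 ∧
      cs.simple t * (cs.simple u * v) = cs.simple p * cs.simple x := by
  have lt := desc_len cs ht
  have lu := desc_len cs hu
  have htu' := desc_a cs htu ht hu
  have hut' := desc_a cs htu.symm hu ht
  by_cases h : ∀ x, cs.IsLeftDescent v x → x = t ∨ x = u
  · by_cases c1 : CB cs (cs.simple u * v) 1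
    · by_cases c2 : CB cs (cs.simple t * v) 1
      · exfalso
        apply hC
        refine CB_2 cs ht h ((A_bd cs ht c2).mono ?_)
        exact Set.union_subset subset_rfl (absorb cs hu ht (Msymm hM) c1)
      · obtain ⟨p, p1, p2, -⟩ := T3 cs (by omega) hut' c2
        refine ⟨p, u, Or.inr rfl, Msymm p1, ?_⟩
        rw [comm' cs hM, p2]; simp
    · obtain ⟨p, p1, p2, -⟩ := T3 cs (by omega) htu' c1
      refine ⟨p, t, Or.inl rfl, Msymm p1, ?_⟩
      rw [p2]; simp
  · push Not at h
    obtain ⟨p, hp, hpt, hpu⟩ := h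
    by_cases m1 : M t p = 2
    · by_cases m2 : M u p = 2
      · exact absurd (L1_3 cs ht hu hp htu hpt.symm hpu.symm hM m1 m2 (by omega)) hC
      · obtain ⟨h1, h2⟩ := B3 cs (v := cs.simple t * v) (by omega) hpu.symm m2 hut'
          (desc_a cs hpt hp ht)
        refine ⟨p, u, Or.inr rfl, Msymm h1, ?_⟩
        rw [comm' cs hM, h2]; simp
    · obtain ⟨h1, h2⟩ := B3 cs (v := cs.simple u * v) (by omega) hpt.symm m1 htu'
          (desc_a cs hpu hp hu)
      refine ⟨p, t, Or.inl rfl, Msymm h1, ?_⟩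
      rw [h2]; simp

/-! ### Length five -/

lemma E4' {w : W} (hl : cs.length w = 5) {s t : B} (hst : s ≠ t) (hM : M s t ≠ 2)
    (hs : cs.IsLeftDescent w s) (ht : cs.IsLeftDescent w t) (hC : ¬ CB cs (cs.simple s * w) 1) :
    ∃ x, M s x = 3 ∧
      cs.simple t * (cs.simple s * w) = cs.simple s * (cs.simple x * cs.simple s) := by
  classical
  have ht' := desc_a cs hst.symm ht hs
  have hs' := desc_b cs hst hM hs ht
  have l1 := desc_len cs hs
  have l2 := desc_len cs ht'
  by_cases h : ∀ x, cs.IsLeftDescent (cs.simple s * w) x → x = t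
  · have c : ¬ CB cs (cs.simple t * (cs.simple s * w)) 1 := fun c => hC (CB_1 cs ht' h c)
    obtain ⟨p, p1, p2, -⟩ := T3 cs (by omega) hs' c
    exact ⟨p, p1, p2⟩
  push Not at h
  obtain ⟨p, hp, hpt⟩ := h
  have hps : p ≠ s := by
    rintro rfl
    exact not_desc cs hs hp
  have hp' := desc_a cs hpt hp ht'
  have l3 := desc_len cs hp'
  have hs'' := desc_a cs hps.symm hs' hp'
  by_cases m : M p t = 2
  · obtain ⟨q, x, hx, m2, e⟩ := E4 cs (by omega) hpt m hp ht' hC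
    rw [e] at hs''
    have := uniq cs m2 hs''
    subst this
    rcases hx with rfl | rfl
    · refine ⟨x, m2, ?_⟩
      rw [solve cs e]
      have := braid3 cs m2 1
      simpa using this.symm
    · exfalso
      by_cases m3 : M p s = 2
      · have e2 := solve cs (solve cs (solve cs e))
        rw [comm' cs m3, comm cs m, braid3 cs m2] at e2
        simp only [cs.simple_mul_simple_cancel_left] at e2
        have := len_le3 cs x s p
        rw [← e2] at this
        omega
      · obtain ⟨h1, h2⟩ := B3 cs (by omega) hps m3 hp' hs'
        rw [h2] at e
        simp only [cs.simple_mul_simple_cancel_left] at e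
        exact hpt (simple_inj cs (mul_left_cancel e))
  · exfalso
    have ht'' := desc_b cs hpt.symm (Msymm' m) ht' hp
    have := size2 cs (J := {s, t}) (w := cs.simple p * (cs.simple t * (cs.simple s * w)))
      (by simp [hs'', ht'']) (p := s) (q := t) (by simp) (by simp) hst hM
    rw [Finset.card_pair hst] at this
    omega

lemma M3_of {w : W} (hl : cs.length w = 5) {s t x y : B} (hst : s ≠ t)
    (ht : cs.IsLeftDescent w t) (hx : M s x = 3) (hy : M t y = 3)
    (e1 : cs.simple t * (cs.simple s * w) = cs.simple s * (cs.simple x * cs.simple s))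
    (e2 : cs.simple s * (cs.simple t * w) = cs.simple t * (cs.simple y * cs.simple t)) :
    M s t = 3 := by
  have e3 := solve cs (solve cs e1)
  have e4 : cs.wordProd [s, t, s, x, s] = w := by
    rw [e3]; simp [cs.wordProd_cons]
  have l1 := desc_len cs ht
  obtain ⟨j, hj, hj'⟩ := exchange cs (ω := [s, t, s, x, s]) t (by rwa [e4])
  rw [e4] at hj'
  simp only [List.length_cons, List.length_nil] at hj
  interval_cases j
  · exfalso
    simp [cs.wordProd_cons] at hj'
    have := len_le3 cs s x s
    rw [← hj'] at this
    omega
  · exfalso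
    simp [cs.wordProd_cons] at hj'
    have := len_le2 cs x s
    rw [← hj'] at this
    omega
  · apply braid_imp cs hst
    simp [cs.wordProd_cons] at hj'
    have h1 := solve cs hj'
    rw [e3] at h1
    have h2 : (cs.simple s * cs.simple t * cs.simple s) * (cs.simple x * cs.simple s) =
      (cs.simple t * cs.simple s * cs.simple t) * (cs.simple x * cs.simple s) := by
      simpa only [mul_assoc] using h1
    exact mul_right_cancel h2
  · exfalso
    simp [cs.wordProd_cons] at hj'
    have := len_le2 cs s t
    rw [← hj'] at this
    omega
  · simp [cs.wordProd_cons] at hj'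
    rw [hj'] at e2
    simp only [cs.simple_mul_simple_cancel_left] at e2
    obtain ⟨h1, h2⟩ := uniq2 cs hx (Msymm hy) (mul_left_cancel e2)
    rw [← h2]
    exact hx

lemma N5 {w : W} (hl : cs.length w = 5) {s t u : B} (hst : s ≠ t) (hsu : s ≠ u) (htu : t ≠ u)
    (hM : M s t ≠ 2) (hs : cs.IsLeftDescent w s) (ht : cs.IsLeftDescent w t)
    (hu : cs.IsLeftDescent w u) : CB cs (cs.simple s * w) 1 := by
  by_contra hC
  obtain ⟨m1, m2⟩ := szP3 cs hs ht hu hst hsu htu hM (by omega)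
  have l1 := desc_len cs hs
  have ht' := desc_a cs hst.symm ht hs
  have hu' := desc_a cs hsu.symm hu hs
  obtain ⟨p, x, hx, m3, e⟩ := E4 cs (by omega) htu m2 ht' hu' hC
  have h1 := desc_b cs hst hM hs ht
  have h2 := desc_a cs hsu h1 (desc_a cs htu.symm hu' ht')
  rw [← comm' cs m2, e] at h2
  have := uniq cs m3 h2
  subst this
  rcases hx with rfl | rfl
  · have e2 := solve cs (solve cs (solve cs e))
    rw [comm' cs m1, braid3 cs m3] at e2
    simp only [cs.simple_mul_simple_self, mul_one] at e2
    have := len_le3 cs u x s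
    rw [← e2] at this
    omega
  · omega

lemma CB5 {w : W} (hl : cs.length w = 5) : CB cs w 3 := by
  by_cases hN : ∃ s t, s ≠ t ∧ M s t ≠ 2 ∧ cs.IsLeftDescent w s ∧ cs.IsLeftDescent w t
  · obtain ⟨s, t, hst, hM, hs, ht⟩ := hN
    have l1 := desc_len cs hs
    have l2 := desc_len cs ht
    by_cases h : ∀ x, cs.IsLeftDescent w x → x = s ∨ x = t
    · by_cases c1 : CB cs (cs.simple s * w) 1
      · exact CB_2 cs hs h ((A_bd cs hs c1).union (A_bd cs ht (CB4 cs (by omega))))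
      by_cases c2 : CB cs (cs.simple t * w) 1
      · exact CB_2 cs hs h ((A_bd cs hs (CB4 cs (by omega))).union (A_bd cs ht c2))
      exfalso
      obtain ⟨x, hx, e1⟩ := E4' cs hl hst hM hs ht c1
      obtain ⟨y, hy, e2⟩ := E4' cs hl hst.symm (Msymm' hM) ht hs c2
      have m := M3_of cs hl hst ht hx hy e1 e2
      have e3 := solve cs (solve cs e1)
      have e4 := solve cs (solve cs e2)
      rw [braid3 cs m] at e3
      rw [e3] at e4
      have e5 := mul_left_cancel (mul_left_cancel (mul_left_cancel e4))
      exact hst (uniq2 cs (Msymm hx) (Msymm hy) e5).2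
    push Not at h
    obtain ⟨u, hu, hus, hut⟩ := h
    have l3 := desc_len cs hu
    obtain ⟨m1, m2⟩ := szP3 cs hs ht hu hst hus.symm hut.symm hM (by omega)
    have c1 := N5 cs hl hst hus.symm hut.symm hM hs ht hu
    have c2 := N5 cs hl hst.symm hut.symm hus.symm (Msymm' hM) ht hs hu
    have a1 := absorb cs hs hu m1 c1
    have a2 := absorb cs ht hu m2 c2
    by_cases h : ∀ x, cs.IsLeftDescent w x → x = s ∨ x = t ∨ x = u
    · refine CB_of cs (by omega) ((A_bd cs hu (CB4 cs (by omega))).le (by norm_num)) ?_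
      intro x hx
      rcases h x hx with rfl | rfl | rfl
      · exact a1
      · exact a2
      · exact subset_rfl
    push Not at h
    obtain ⟨b, hb, hbs, hbt, hbu⟩ := h
    have l4 := desc_len cs hb
    have m3 := (sz4 cs hs ht hu hb hst hus.symm hut.symm hbs.symm hbt.symm hbu.symm hM).2.1
      (by omega)
    obtain ⟨z, z1, z2⟩ := common2 cs hu hb m3
    refine CB_of cs (by omega) ((A_bd cs hu (CB4 cs (by omega))).union1
      (A_bd cs hb (CB4 cs (by omega))) z1 z2 (k := 3) (by norm_num)) ?_
    intro x hx
    by_cases hxs : x = s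
    · subst hxs; exact a1.trans Set.subset_union_left
    by_cases hxt : x = t
    · subst hxt; exact a2.trans Set.subset_union_left
    by_cases hxu : x = u
    · subst hxu; exact Set.subset_union_left
    by_cases hxb : x = b
    · subst hxb; exact Set.subset_union_right
    have := sz5 cs hs ht hu hb hx hst hus.symm hut.symm hbs.symm hbt.symm hbu.symm
      (Ne.symm hxs) (Ne.symm hxt) (Ne.symm hxu) (Ne.symm hxb) hM
    omega
  · push Not at hN
    have hc : ∀ a b, a ≠ b → cs.IsLeftDescent w a → cs.IsLeftDescent w b → M a b = 2 := by
      intro a b hab ha hb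
      by_contra hM
      exact hN a b hab hM ha hb
    obtain ⟨s, hs⟩ := ex_desc cs (w := w) (by omega)
    have ls := desc_len cs hs
    by_cases h : ∀ x, cs.IsLeftDescent w x → x = s
    · exact CB_1 cs hs h ((CB4 cs (by omega)).le (by norm_num))
    push Not at h
    obtain ⟨t, ht, hts⟩ := h
    have lt := desc_len cs ht
    have m1 := hc s t hts.symm hs ht
    by_cases h : ∀ x, cs.IsLeftDescent w x → x = s ∨ x = t
    · obtain ⟨z, z1, z2⟩ := common2 cs hs ht m1
      exact CB_2 cs hs h ((A_bd cs hs (CB4 cs (by omega))).union1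
        (A_bd cs ht (CB4 cs (by omega))) z1 z2 (by norm_num))
    push Not at h
    obtain ⟨u, hu, hus, hut⟩ := h
    have lu := desc_len cs hu
    have m2 := hc s u hus.symm hs hu
    have m3 := hc t u hut.symm ht hu
    by_cases h : ∀ x, cs.IsLeftDescent w x → x = s ∨ x = t ∨ x = u
    · have key : ∀ a b c, (∀ x, cs.IsLeftDescent w x → x = a ∨ x = b ∨ x = c) →
          cs.IsLeftDescent w a → cs.IsLeftDescent w b → cs.IsLeftDescent w c → M a b = 2 →
          M b c = 2 → CB cs (cs.simple a * w) 1 → CB cs w 3 := by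
        intro a b c h ha hb hc' mab mbc c1
        obtain ⟨z, z1, z2⟩ := common2 cs hb hc' mbc
        have lb := desc_len cs hb
        have lc := desc_len cs hc'
        refine CB_of cs (by omega) ((A_bd cs hb (CB4 cs (by omega))).union1
          (A_bd cs hc' (CB4 cs (by omega))) z1 z2 (by norm_num)) ?_
        intro x hx
        rcases h x hx with rfl | rfl | rfl
        · exact (absorb cs ha hb mab c1).trans Set.subset_union_left
        · exact Set.subset_union_left
        · exact Set.subset_union_right
      by_cases c1 : CB cs (cs.simple s * w) 1
      · exact key s t u h hs ht hu m1 m3 c1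
      by_cases c2 : CB cs (cs.simple t * w) 1
      · exact key t s u (fun x hx => by have := h x hx; tauto) ht hs hu (Msymm m1) m2 c2
      by_cases c3 : CB cs (cs.simple u * w) 1
      · exact key u s t (fun x hx => by have := h x hx; tauto) hu hs ht (Msymm m2) m1 c3
      exfalso
      obtain ⟨p, x, hx, n1, e1⟩ := E4 cs (by omega) hut.symm m3 (desc_a cs hts ht hs)
        (desc_a cs hus hu hs) c1
      obtain ⟨q, y, hy, n2, e2⟩ := E4 cs (by omega) hus.symm m2 (desc_a cs hts.symm hs ht)
        (desc_a cs hut hu ht) c2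
      obtain ⟨r, z, hz, n3, e3⟩ := E4 cs (by omega) hts.symm m1 (desc_a cs hus.symm hs hu)
        (desc_a cs hut.symm ht hu) c3
      rw [comm' cs (Msymm m2), comm' cs (Msymm m1), e3] at e1
      rw [comm' cs (Msymm m3), e3] at e2
      obtain ⟨-, rfl⟩ := uniq2 cs n3 n1 e1
      obtain ⟨-, rfl⟩ := uniq2 cs n3 n2 e2
      clear * - hx hy hz hts hus hut
      grind
    push Not at h
    obtain ⟨v, hv, hvs, hvt, hvu⟩ := h
    exact (L1_4 cs hs ht hu hv hts.symm hus.symm hut.symm hvs.symm hvt.symm hvu.symm m1 m2 m3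
      (hc _ _ hvs.symm hs hv) (hc _ _ hvt.symm ht hv) (hc _ _ hvu.symm hu hv) (by omega)).le
      (by norm_num)

end Upper2

end CoxCount

namespace CoxCount

section Upper3

variable {B : Type*} {M : CoxeterMatrix B} {W : Type*} [Group W] (cs : CoxeterSystem M W)

/-! ### Length six -/

lemma E5a {v : W} (hl : cs.length v = 5) {t u x p : B} (htu : t ≠ u) (htx : t ≠ x) (hux : u ≠ x)
    (hpt : p ≠ t) (hpu : p ≠ u) (hpx : p ≠ x) (m1 : M t u = 2) (m2 : M t x = 2)
    (ht : cs.IsLeftDescent v t) (hu : cs.IsLeftDescent v u) (hx : cs.IsLeftDescent v x)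
    (hp : cs.IsLeftDescent v p) (c1 : CB cs (cs.simple t * v) 1) (c2 : CB cs (cs.simple u * v) 1)
    (c3 : CB cs (cs.simple x * v) 1) (hM : M p t ≠ 2) : CB cs v 2 := by
  have c4 := N5 cs hl hpt hpu htu hM hp ht hu
  refine CB_of cs (by omega) ((A_bd cs ht c1).union (A_bd cs hp c4)) ?_
  intro y hy
  by_cases hyt : y = t
  · subst hyt; exact Set.subset_union_left
  by_cases hyp : y = p
  · subst hyp; exact Set.subset_union_right
  by_cases hyu : y = u
  · subst hyu; exact (absorb cs hu ht (Msymm m1) c2).trans Set.subset_union_left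
  by_cases hyx : y = x
  · subst hyx; exact (absorb cs hx ht (Msymm m2) c3).trans Set.subset_union_left
  have := sz5 cs hp ht hu hx hy hpt hpu htu hpx htx hux (Ne.symm hyp) (Ne.symm hyt) (Ne.symm hyu)
    (Ne.symm hyx) hM
  omega

lemma E5 {v : W} (hl : cs.length v = 5) {t u x : B} (htu : t ≠ u) (htx : t ≠ x) (hux : u ≠ x)
    (m1 : M t u = 2) (m2 : M t x = 2) (m3 : M u x = 2)
    (ht : cs.IsLeftDescent v t) (hu : cs.IsLeftDescent v u) (hx : cs.IsLeftDescent v x)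
    (hC : ¬ CB cs v 2) :
    ∃ q y, M q y = 3 ∧ (y = t ∨ y = u ∨ y = x) ∧
      cs.simple t * (cs.simple u * (cs.simple x * v)) = cs.simple q * cs.simple y := by
  have lt := desc_len cs ht
  have lu := desc_len cs hu
  have lx := desc_len cs hx
  by_cases c1 : CB cs (cs.simple t * v) 1
  · by_cases c2 : CB cs (cs.simple u * v) 1
    · by_cases c3 : CB cs (cs.simple x * v) 1
      · exfalso
        by_cases h : ∀ y, cs.IsLeftDescent v y → y = t ∨ y = u ∨ y = x
        · apply hC
          refine CB_of cs (by omega) ((A_bd cs ht c1).le (by norm_num)) ?_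
          intro y hy
          rcases h y hy with rfl | rfl | rfl
          · exact subset_rfl
          · exact absorb cs hu ht (Msymm m1) c2
          · exact absorb cs hx ht (Msymm m2) c3
        push Not at h
        obtain ⟨p, hp, hpt, hpu, hpx⟩ := h
        by_cases n1 : M p t = 2
        · by_cases n2 : M p u = 2
          · by_cases n3 : M p x = 2
            · exact hC ((L1_4 cs hp ht hu hx hpt hpu htu hpx htx hux n1 n2 m1 n3 m2 m3
                (by omega)).le (by norm_num))
            · exact hC (E5a cs hl htx.symm hux.symm htu hpx hpt hpu (Msymm m2) (Msymm m3)
                hx ht hu hp c3 c1 c2 n3)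
          · exact hC (E5a cs hl htu.symm hux htx hpu hpt hpx (Msymm m1) m3
                hu ht hx hp c2 c1 c3 n2)
        · exact hC (E5a cs hl htu htx hux hpt hpu hpx m1 m2 ht hu hx hp c1 c2 c3 n1)
      · obtain ⟨p, y, hy, n, e⟩ := E4 cs (by omega) htu m1 (desc_a cs htx ht hx)
          (desc_a cs hux hu hx) c3
        exact ⟨p, y, n, by tauto, e⟩
    · obtain ⟨p, y, hy, n, e⟩ := E4 cs (by omega) htx m2 (desc_a cs htu ht hu)
          (desc_a cs hux.symm hx hu) c2
      refine ⟨p, y, n, by tauto, ?_⟩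
      rw [comm' cs m3, e]
  · obtain ⟨p, y, hy, n, e⟩ := E4 cs (by omega) hux m3 (desc_a cs htu.symm hu ht)
          (desc_a cs htx.symm hx ht) c1
    refine ⟨p, y, n, by tauto, ?_⟩
    rw [comm' cs m1, comm' cs m2, e]

lemma CB6three {w : W} (hl : cs.length w = 6) {a b c : B} (hM : M a b = 2)
    (ha : cs.IsLeftDescent w a) (hb : cs.IsLeftDescent w b) (hc : cs.IsLeftDescent w c)
    (h : ∀ x, cs.IsLeftDescent w x → x = a ∨ x = b ∨ x = c) : CB cs w 8 := by
  obtain ⟨z, z1, z2⟩ := common2 cs ha hb hM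
  have la := desc_len cs ha
  have lb := desc_len cs hb
  have lc := desc_len cs hc
  refine CB_of cs (by omega) (((A_bd cs ha (CB5 cs (by omega))).union1
    (A_bd cs hb (CB5 cs (by omega))) z1 z2 (k := 5) (by norm_num)).union
    (A_bd cs hc (CB5 cs (by omega)))) ?_
  intro x hx
  rcases h x hx with rfl | rfl | rfl
  · exact Set.subset_union_left.trans Set.subset_union_left
  · exact Set.subset_union_right.trans Set.subset_union_left
  · exact Set.subset_union_right

lemma CB6four {w : W} (hl : cs.length w = 6) {a b c d : B}
    (hab : a ≠ b) (hac : a ≠ c) (hbc : b ≠ c) (had : a ≠ d) (hbd : b ≠ d) (hcd : c ≠ d)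
    (ha : cs.IsLeftDescent w a) (hb : cs.IsLeftDescent w b) (hc : cs.IsLeftDescent w c)
    (hd : cs.IsLeftDescent w d)
    (m1 : M a b = 2) (m2 : M a c = 2) (m3 : M b c = 2) (m4 : M a d = 2) (m5 : M b d = 2)
    (m6 : M c d = 2)
    (h : ∀ x, cs.IsLeftDescent w x → x = a ∨ x = b ∨ x = c ∨ x = d)
    (hC : CB cs (cs.simple a * w) 2) : CB cs w 8 := by
  classical
  obtain ⟨z, hz⟩ := common cs {a, b, c, d} w (by simp [*]) (by
    have := Msymm m1
    have := Msymm m2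
    have := Msymm m3
    have := Msymm m4
    have := Msymm m5
    have := Msymm m6
    simp_all)
  have za := hz a (by simp)
  have zb := hz b (by simp)
  have zc := hz c (by simp)
  have zd := hz d (by simp)
  have lb := desc_len cs hb
  have lc := desc_len cs hc
  have ld := desc_len cs hd
  have b1 := (A_bd cs ha hC).union1 (A_bd cs hb (CB5 cs (by omega))) za zb (k := 4) (by norm_num)
  have b2 := b1.union1 (A_bd cs hc (CB5 cs (by omega))) (Or.inl za) zc (k := 6) (by norm_num)
  have b3 := b2.union1 (A_bd cs hd (CB5 cs (by omega))) (Or.inl (Or.inl za)) zd (k := 8)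
    (by norm_num)
  refine CB_of cs (by omega) b3 ?_
  intro x hx y hy
  rcases h x hx with rfl | rfl | rfl | rfl
  · exact Or.inl (Or.inl (Or.inl hy))
  · exact Or.inl (Or.inl (Or.inr hy))
  · exact Or.inl (Or.inr hy)
  · exact Or.inr hy

lemma CB6 {w : W} (hl : cs.length w = 6) : CB cs w 8 := by
  by_cases hN : ∃ s t, s ≠ t ∧ M s t ≠ 2 ∧ cs.IsLeftDescent w s ∧ cs.IsLeftDescent w t
  · obtain ⟨s, t, hst, hM, hs, ht⟩ := hN
    have ls := desc_len cs hs
    have lt := desc_len cs ht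
    have bs := A_bd cs hs (CB5 cs (by omega))
    have bt := A_bd cs ht (CB5 cs (by omega))
    by_cases h : ∀ x, cs.IsLeftDescent w x → x = s ∨ x = t
    · exact CB_2 cs hs h ((bs.union bt).le (by norm_num))
    push Not at h
    obtain ⟨u, hu, hus, hut⟩ := h
    have lu := desc_len cs hu
    have bu := A_bd cs hu (CB5 cs (by omega))
    by_cases h : ∀ x, cs.IsLeftDescent w x → x = s ∨ x = t ∨ x = u
    · by_cases m1 : M s u = 2
      · exact CB6three cs hl m1 hs hu ht (fun x hx => by have := h x hx; tauto)
      by_cases m2 : M t u = 2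
      · exact CB6three cs hl m2 ht hu hs (fun x hx => by have := h x hx; tauto)
      exact (no_tri cs hst hut.symm hus.symm hM m2 m1 hs ht hu).elim
    push Not at h
    obtain ⟨v, hv, hvs, hvt, hvu⟩ := h
    have lv := desc_len cs hv
    have bv := A_bd cs hv (CB5 cs (by omega))
    obtain ⟨msu, mtu⟩ := (sz4 cs hs ht hu hv hst hus.symm hut.symm hvs.symm hvt.symm hvu.symm
      hM).2.2 (by omega)
    obtain ⟨msv, mtv⟩ := (sz4 cs hs ht hv hu hst hvs.symm hvt.symm hus.symm hut.symm hvu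
      hM).2.2 (by omega)
    by_cases h : ∀ x, cs.IsLeftDescent w x → x = s ∨ x = t ∨ x = u ∨ x = v
    · by_cases muv : M u v = 2
      · obtain ⟨x, xs, xu, xv⟩ := common3 cs hs hu hv msu msv muv
        obtain ⟨y, yt, yu, yv⟩ := common3 cs ht hu hv mtu mtv muv
        have hxy := disj cs hst hM xs yt
        have b1 := bu.union2 bv hxy xu xv yu yv (k := 4) (by norm_num)
        have b2 := b1.union1 bs (Or.inl xu) xs (k := 6) (by norm_num)
        have b3 := b2.union1 bt (Or.inl (Or.inl yu)) yt (k := 8) (by norm_num)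
        refine CB_of cs (by omega) b3 ?_
        intro x hx y hy
        rcases h x hx with rfl | rfl | rfl | rfl
        · exact Or.inl (Or.inr hy)
        · exact Or.inr hy
        · exact Or.inl (Or.inl (Or.inl hy))
        · exact Or.inl (Or.inl (Or.inr hy))
      · obtain ⟨x1, x1s, x1u⟩ := common2 cs hs hu msu
        obtain ⟨x2, x2t, x2u⟩ := common2 cs ht hu mtu
        obtain ⟨x3, x3s, x3v⟩ := common2 cs hs hv msv
        obtain ⟨x4, x4t, x4v⟩ := common2 cs ht hv mtv
        have hxy := disj cs hst hM x3s x4t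
        have b1 := bs.union1 bu x1s x1u (k := 5) (by norm_num)
        have b2 := b1.union1 bt (Or.inr x2u) x2t (k := 7) (by norm_num)
        have b3 := b2.union2 bv hxy (Or.inl (Or.inl x3s)) x3v (Or.inr x4t) x4v (k := 8)
          (by norm_num)
        refine CB_of cs (by omega) b3 ?_
        intro x hx y hy
        rcases h x hx with rfl | rfl | rfl | rfl
        · exact Or.inl (Or.inl (Or.inl hy))
        · exact Or.inl (Or.inr hy)
        · exact Or.inl (Or.inl (Or.inr hy))
        · exact Or.inr hy
    push Not at h
    obtain ⟨a, ha, has, hat, hau, hav⟩ := h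
    have la := desc_len cs ha
    have ba := A_bd cs ha (CB5 cs (by omega))
    obtain ⟨msa, mta⟩ := (sz4 cs hs ht ha hu hst has.symm hat.symm hus.symm hut.symm hau
      hM).2.2 (by omega)
    have muv := (sz5 cs hs ht hu hv ha hst hus.symm hut.symm hvs.symm hvt.symm hvu.symm has.symm
      hat.symm hau.symm hav.symm hM).2 (by omega)
    have mua := (sz5 cs hs ht hu ha hv hst hus.symm hut.symm has.symm hat.symm hau.symm hvs.symm
      hvt.symm hvu.symm hav hM).2 (by omega)
    have mva := (sz5 cs hs ht hv ha hu hst hvs.symm hvt.symm has.symm hat.symm hav.symm hus.symm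
      hut.symm hvu hau hM).2 (by omega)
    have c1 : CB cs (cs.simple s * w) 1 :=
      L1_4 cs (desc_a cs hst.symm ht hs) (desc_a cs hus hu hs) (desc_a cs hvs hv hs)
        (desc_a cs has ha hs) hut.symm hvt.symm hvu.symm hat.symm hau.symm hav.symm
        mtu mtv muv mta mua mva (by omega)
    have c2 : CB cs (cs.simple t * w) 1 :=
      L1_4 cs (desc_a cs hst hs ht) (desc_a cs hut hu ht) (desc_a cs hvt hv ht)
        (desc_a cs hat ha ht) hus.symm hvs.symm hvu.symm has.symm hau.symm hav.symm
        msu msv muv msa mua mva (by omega)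
    obtain ⟨z, zu, zv, za⟩ := common3 cs hu hv ha muv mua mva
    have b1 := bu.union1 bv zu zv (k := 5) (by norm_num)
    have b2 := b1.union1 ba (Or.inl zu) za (k := 8) (by norm_num)
    refine CB_of cs (by omega) b2 ?_
    intro x hx y hy
    by_cases hxs : x = s
    · subst hxs; exact Or.inl (Or.inl (absorb cs hs hu msu c1 hy))
    by_cases hxt : x = t
    · subst hxt; exact Or.inl (Or.inl (absorb cs ht hu mtu c2 hy))
    by_cases hxu : x = u
    · subst hxu; exact Or.inl (Or.inl hy)
    by_cases hxv : x = v
    · subst hxv; exact Or.inl (Or.inr hy)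
    by_cases hxa : x = a
    · subst hxa; exact Or.inr hy
    have := sz6 cs hs ht hu hv ha hx hst hus.symm hut.symm hvs.symm hvt.symm hvu.symm has.symm
      hat.symm hau.symm hav.symm (Ne.symm hxs) (Ne.symm hxt) (Ne.symm hxu) (Ne.symm hxv)
      (Ne.symm hxa) hM
    omega
  · push Not at hN
    have hc : ∀ a b, a ≠ b → cs.IsLeftDescent w a → cs.IsLeftDescent w b → M a b = 2 := by
      intro a b hab ha hb
      by_contra hM
      exact hN a b hab hM ha hb
    obtain ⟨s, hs⟩ := ex_desc cs (w := w) (by omega)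
    have ls := desc_len cs hs
    by_cases h : ∀ x, cs.IsLeftDescent w x → x = s
    · exact CB_1 cs hs h ((CB5 cs (by omega)).le (by norm_num))
    push Not at h
    obtain ⟨t, ht, hts⟩ := h
    have lt := desc_len cs ht
    have m1 := hc s t hts.symm hs ht
    by_cases h : ∀ x, cs.IsLeftDescent w x → x = s ∨ x = t
    · exact CB6three cs hl m1 hs ht ht (fun x hx => by have := h x hx; tauto)
    push Not at h
    obtain ⟨u, hu, hus, hut⟩ := h
    have lu := desc_len cs hu
    have m2 := hc s u hus.symm hs hu
    have m3 := hc t u hut.symm ht hu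
    by_cases h : ∀ x, cs.IsLeftDescent w x → x = s ∨ x = t ∨ x = u
    · exact CB6three cs hl m1 hs ht hu h
    push Not at h
    obtain ⟨v, hv, hvs, hvt, hvu⟩ := h
    have lv := desc_len cs hv
    have m4 := hc s v hvs.symm hs hv
    have m5 := hc t v hvt.symm ht hv
    have m6 := hc u v hvu.symm hu hv
    by_cases h : ∀ x, cs.IsLeftDescent w x → x = s ∨ x = t ∨ x = u ∨ x = v
    · by_cases c1 : CB cs (cs.simple s * w) 2
      · exact CB6four cs hl hts.symm hus.symm hut.symm hvs.symm hvt.symm hvu.symm hs ht hu hv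
          m1 m2 m3 m4 m5 m6 h c1
      by_cases c2 : CB cs (cs.simple t * w) 2
      · exact CB6four cs hl hts hut.symm hus.symm hvt.symm hvs.symm hvu.symm ht hs hu hv
          (Msymm m1) m3 m2 m5 m4 m6 (fun x hx => by have := h x hx; tauto) c2
      by_cases c3 : CB cs (cs.simple u * w) 2
      · exact CB6four cs hl hus hut hts.symm hvu.symm hvs.symm hvt.symm hu hs ht hv
          (Msymm m2) (Msymm m3) m1 m6 m4 m5 (fun x hx => by have := h x hx; tauto) c3
      by_cases c4 : CB cs (cs.simple v * w) 2
      · exact CB6four cs hl hvs hvt hts.symm hvu hus.symm hut.symm hv hs ht hu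
          (Msymm m4) (Msymm m5) m1 (Msymm m6) m2 m3 (fun x hx => by have := h x hx; tauto) c4
      exfalso
      obtain ⟨p1, y1, n1, k1, e1⟩ := E5 cs (by omega) hut.symm hvt.symm hvu.symm m3 m5 m6
        (desc_a cs hts ht hs) (desc_a cs hus hu hs) (desc_a cs hvs hv hs) c1
      obtain ⟨p2, y2, n2, k2, e2⟩ := E5 cs (by omega) hus.symm hvs.symm hvu.symm m2 m4 m6
        (desc_a cs hts.symm hs ht) (desc_a cs hut hu ht) (desc_a cs hvt hv ht) c2
      obtain ⟨p3, y3, n3, k3, e3⟩ := E5 cs (by omega) hts.symm hvs.symm hvt.symm m1 m4 m5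
        (desc_a cs hus.symm hs hu) (desc_a cs hut.symm ht hu) (desc_a cs hvu hv hu) c3
      obtain ⟨p4, y4, n4, k4, e4⟩ := E5 cs (by omega) hts.symm hus.symm hut.symm m1 m2 m3
        (desc_a cs hvs.symm hs hv) (desc_a cs hvt.symm ht hv) (desc_a cs hvu.symm hu hv) c4
      rw [comm' cs (Msymm m4), comm' cs (Msymm m2), comm' cs (Msymm m1), e4] at e1
      rw [comm' cs (Msymm m5), comm' cs (Msymm m3), e4] at e2
      rw [comm' cs (Msymm m6), e4] at e3
      have f1 := (uniq2 cs n4 n1 e1).2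
      have f2 := (uniq2 cs n4 n2 e2).2
      have f3 := (uniq2 cs n4 n3 e3).2
      clear * - f1 f2 f3 k1 k2 k3 k4 hts hus hut hvs hvt hvu
      grind
    push Not at h
    obtain ⟨a, ha, has, hat, hau, hav⟩ := h
    classical
    refine (L1 cs _ w {s, t, u, v, a} rfl (by simp [*]) ?_ ?_).le (by norm_num)
    · intro x hx y hy hxy
      refine hc x y hxy ?_ ?_
      · simp only [Finset.mem_insert, Finset.mem_singleton] at hx
        rcases hx with rfl | rfl | rfl | rfl | rfl <;> assumption
      · simp only [Finset.mem_insert, Finset.mem_singleton] at hy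
        rcases hy with rfl | rfl | rfl | rfl | rfl <;> assumption
    · have : Finset.card {s, t, u, v, a} = 5 := by
        simp [hts.symm, hus.symm, hut.symm, hvs.symm, hvt.symm, hvu.symm, has.symm, hat.symm,
          hau.symm, hav.symm]
      omega

lemma CC_le {w : W} {n : ℕ} (h : CB cs w n) : CC cs w ≤ n := by
  have := h.2
  rw [Set.ncard_univ] at this
  exact this

end Upper3

end CoxCount

namespace CoxCount

section Lower

/-- The Coxeter matrix of type `A₃`. -/
def MA : CoxeterMatrix (Fin 3) where
  M := !![1, 3, 2; 3, 1, 3; 2, 3, 1]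
  isSymm := by decide
  diagonal := by decide
  off_diagonal := by
    intro i j
    fin_cases i <;> fin_cases j <;> simp

/-- The Coxeter system of type `A₃`. -/
abbrev cA : CoxeterSystem MA MA.Group := MA.toCoxeterSystem

/-- The adjacent transpositions of four points. -/
def tr : Fin 3 → Equiv.Perm (Fin 4) := ![Equiv.swap 0 1, Equiv.swap 1 2, Equiv.swap 2 3]

lemma tr_lift : MA.IsLiftable tr := by
  unfold CoxeterMatrix.IsLiftable
  decide

/-- The permutation representation. -/
def ph : MA.Group →* Equiv.Perm (Fin 4) := cA.lift ⟨tr, tr_lift⟩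

lemma ph_simple (i : Fin 3) : ph (cA.simple i) = tr i := cA.lift_apply_simple tr_lift i

/-- The number of inversions. -/
def inv4 (f : Fin 4 → Fin 4) : ℕ :=
  ((Finset.univ : Finset (Fin 4 × Fin 4)).filter (fun p => p.1 < p.2 ∧ f p.2 < f p.1)).card

lemma inv_step (f : Equiv.Perm (Fin 4)) (i : Fin 3) : inv4 (f * tr i : Equiv.Perm (Fin 4)) ≤ inv4 f + 1 := by
  revert f i
  decide +kernel

lemma inv_le (ω : List (Fin 3)) : inv4 (ph (cA.wordProd ω)) ≤ ω.length := by
  induction ω using List.reverseRecOn with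
  | nil => simp; decide
  | append_singleton ω i ih =>
    rw [cA.wordProd_append, map_mul, cA.wordProd_singleton, ph_simple]
    have := inv_step (ph (cA.wordProd ω)) i
    simp only [List.length_append, List.length_singleton]
    omega

lemma red6 : cA.IsReduced [0, 1, 0, 2, 1, 0] := by
  obtain ⟨ω, h1, h2⟩ := cA.exists_isReduced (cA.wordProd [0, 1, 0, 2, 1, 0])
  have h3 := inv_le ω
  have h4 : cA.length _ = _ := h1
  rw [← h2] at h4 h3
  have h5 : inv4 (ph (cA.wordProd [0, 1, 0, 2, 1, 0])) = 6 := by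
    simp only [cA.wordProd_cons, cA.wordProd_nil, map_mul, map_one, ph_simple]
    decide
  have h6 := cA.length_wordProd_le [0, 1, 0, 2, 1, 0]
  unfold CoxeterSystem.IsReduced
  simp only [List.length_cons, List.length_nil] at h6 ⊢
  omega

/-- A commutation invariant. -/
def fl (ω : List (Fin 3)) : List (Fin 3) × List (Fin 3) :=
  (ω.filter (fun x => x ≠ 2), ω.filter (fun x => x ≠ 0))

lemma MA_two {a b : Fin 3} (h : MA a b = 2) : (a = 0 ∧ b = 2) ∨ (a = 2 ∧ b = 0) := by
  have key : ∀ a b : Fin 3, MA a b = 2 → (a = 0 ∧ b = 2) ∨ (a = 2 ∧ b = 0) := by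
    intro a b
    fin_cases a <;> fin_cases b <;> decide
  exact key a b h

lemma lower {w : MA.Group} {k n : ℕ} (hl : cA.length w = k) (hC : CB cA w n)
    (ws : Fin n → List (Fin 3)) (h1 : ∀ i, cA.wordProd (ws i) = w) (h2 : ∀ i, (ws i).length = k)
    (h3 : Function.Injective (fun i => fl (ws i))) : CC cA w = n := by
  apply le_antisymm (CC_le cA hC)
  have : Finite (Cls cA w) := Set.finite_univ_iff.1 hC.1
  let F : Cls cA w → List (Fin 3) × List (Fin 3) := Quot.lift (fun ω => fl ω.1) (by
    rintro ⟨u, hu⟩ ⟨v, hv⟩ ⟨x, y, a, b, hab, rfl, rfl⟩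
    rcases MA_two hab with ⟨rfl, rfl⟩ | ⟨rfl, rfl⟩ <;> simp [fl])
  let G : Fin n → Cls cA w := fun i => Quot.mk _ ⟨ws i, h1 i, by
    unfold CoxeterSystem.IsReduced
    rw [h1, hl, h2]⟩
  have hG : Function.Injective G := by
    intro i j hij
    exact h3 (congrArg F hij)
  have := Nat.card_le_card_of_injective G hG
  rw [Nat.card_fin] at this
  exact this

lemma br01 (w : MA.Group) : cA.simple 1 * (cA.simple 0 * (cA.simple 1 * w)) =
    cA.simple 0 * (cA.simple 1 * (cA.simple 0 * w)) := braid3 cA (by decide) w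

lemma br12 (w : MA.Group) : cA.simple 1 * (cA.simple 2 * (cA.simple 1 * w)) =
    cA.simple 2 * (cA.simple 1 * (cA.simple 2 * w)) := braid3 cA (by decide) w

lemma co02 (w : MA.Group) : cA.simple 0 * (cA.simple 2 * w) =
    cA.simple 2 * (cA.simple 0 * w) := comm' cA (by decide) w

lemma wp_br01 (u v : List (Fin 3)) : cA.wordProd (u ++ 1 :: 0 :: 1 :: v) =
    cA.wordProd (u ++ 0 :: 1 :: 0 :: v) := by
  simp only [cA.wordProd_append, cA.wordProd_cons, br01]

lemma wp_br12 (u v : List (Fin 3)) : cA.wordProd (u ++ 1 :: 2 :: 1 :: v) =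
    cA.wordProd (u ++ 2 :: 1 :: 2 :: v) := by
  simp only [cA.wordProd_append, cA.wordProd_cons, br12]

lemma wp_co02 (u v : List (Fin 3)) : cA.wordProd (u ++ 0 :: 2 :: v) =
    cA.wordProd (u ++ 2 :: 0 :: v) := by
  simp only [cA.wordProd_append, cA.wordProd_cons, co02]

lemma Mnum_eq {k n : ℕ} (hU : ∀ (B : Type) (M : CoxeterMatrix B) (w : M.Group),
    M.toCoxeterSystem.length w = k → CB M.toCoxeterSystem w n)
    (ω : List (Fin 3)) (hω : cA.IsReduced ω) (hk : ω.length = k)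
    (ws : Fin n → List (Fin 3)) (h1 : ∀ i, cA.wordProd (ws i) = cA.wordProd ω)
    (h2 : ∀ i, (ws i).length = k)
    (h3 : Function.Injective (fun i => fl (ws i))) : Mnum k = n := by
  have hl : cA.length (cA.wordProd ω) = k := by
    rw [← hk]; exact hω
  apply IsGreatest.csSup_eq
  constructor
  · exact ⟨Fin 3, MA, cA.wordProd ω, hl, lower hl (hU _ _ _ hl) ws h1 h2 h3⟩
  · rintro m ⟨B, M, w, hw, rfl⟩
    exact CC_le _ (hU B M w hw)

lemma b5 : cA.wordProd [1, 0, 2, 1, 2] = cA.wordProd [0, 1, 0, 2, 1] :=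
  (wp_br12 [1, 0] []).symm.trans (wp_br01 [] [2, 1])

lemma c3 : cA.wordProd [0, 1, 2, 1, 0, 1] = cA.wordProd [0, 1, 0, 2, 1, 0] :=
  (wp_br01 [0, 1, 2] []).trans (wp_co02 [0, 1] [1, 0]).symm

lemma c4 : cA.wordProd [1, 0, 2, 1, 2, 0] = cA.wordProd [0, 1, 0, 2, 1, 0] :=
  (wp_br12 [1, 0] [0]).symm.trans (wp_br01 [] [2, 1, 0])

lemma c5 : cA.wordProd [0, 2, 1, 2, 0, 1] = cA.wordProd [0, 1, 0, 2, 1, 0] :=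
  (wp_br12 [0] [0, 1]).symm.trans c3

lemma c6 : cA.wordProd [1, 2, 1, 0, 1, 2] = cA.wordProd [0, 1, 0, 2, 1, 0] :=
  (wp_br01 [1, 2] [2]).trans ((wp_co02 [1] [1, 0, 2]).symm.trans ((wp_co02 [1, 0, 2, 1] []).trans c4))

lemma c7 : cA.wordProd [2, 1, 0, 1, 2, 1] = cA.wordProd [0, 1, 0, 2, 1, 0] :=
  (wp_br01 [2] [2, 1]).trans ((wp_co02 [] [1, 0, 2, 1]).symm.trans
    ((wp_co02 [0, 2, 1] [1]).trans c5))

lemma c8 : cA.wordProd [2, 1, 2, 0, 1, 2] = cA.wordProd [0, 1, 0, 2, 1, 0] :=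
  (wp_br12 [] [0, 1, 2]).symm.trans c6

end Lower

end CoxCount

open CoxCount in
/-- The initial values of `M(k)`. -/
theorem stmt13 :
    Mnum 0 = 1 ∧ Mnum 1 = 1 ∧ Mnum 2 = 1 ∧ Mnum 3 = 2 ∧ Mnum 4 = 2 ∧
    Mnum 5 = 3 ∧ Mnum 6 = 8 := by
  refine ⟨?_, ?_, ?_, ?_, ?_, ?_, ?_⟩
  · exact Mnum_eq (fun B M w h => L1_1 _ (by omega)) [] (red6.take 0) rfl ![[]]
      (by intro i; fin_cases i; rfl) (by decide) (by decide)
  · exact Mnum_eq (fun B M w h => L1_1 _ (by omega)) [0] (red6.take 1) rfl ![[0]]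
      (by intro i; fin_cases i; rfl) (by decide) (by decide)
  · exact Mnum_eq (fun B M w h => L1_1 _ (by omega)) [0, 1] (red6.take 2) rfl ![[0, 1]]
      (by intro i; fin_cases i; rfl) (by decide) (by decide)
  · exact Mnum_eq (fun B M w h => CB3 _ h) [0, 1, 0] (red6.take 3) rfl ![[0, 1, 0], [1, 0, 1]]
      (by
        intro i
        fin_cases i
        · rfl
        · exact wp_br01 [] []) (by decide) (by decide)
  · exact Mnum_eq (fun B M w h => CB4 _ h) [0, 1, 0, 2] (red6.take 4) rfl
      ![[0, 1, 0, 2], [1, 0, 1, 2]]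
      (by
        intro i
        fin_cases i
        · rfl
        · exact wp_br01 [] [2]) (by decide) (by decide)
  · exact Mnum_eq (fun B M w h => CB5 _ h) [0, 1, 0, 2, 1] (red6.take 5) rfl
      ![[0, 1, 0, 2, 1], [1, 0, 1, 2, 1], [1, 0, 2, 1, 2]]
      (by
        intro i
        fin_cases i
        · rfl
        · exact wp_br01 [] [2, 1]
        · exact b5) (by decide) (by decide)
  · exact Mnum_eq (fun B M w h => CB6 _ h) [0, 1, 0, 2, 1, 0] red6 rfl
      ![[0, 1, 0, 2, 1, 0], [1, 0, 1, 2, 1, 0], [0, 1, 2, 1, 0, 1], [1, 0, 2, 1, 2, 0],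
        [0, 2, 1, 2, 0, 1], [1, 2, 1, 0, 1, 2], [2, 1, 0, 1, 2, 1], [2, 1, 2, 0, 1, 2]]
      (by
        intro i
        fin_cases i
        · rfl
        · exact wp_br01 [] [2, 1, 0]
        · exact c3
        · exact c4
        · exact c5
        · exact c6
        · exact c7
        · exact c8) (by decide) (by decide)
end

section
/- The first six values of P(n), the number of commutation classes of reduced words of the longest element of the symmetric group S_n, are P(1) = 1, P(2) = 1, P(3) = 2, P(4) = 8, P(5) = 62, P(6) = 908. -/
/-- The Coxeter system of type `A_{n-1}`, whose group is the symmetric group `Sₙ`. -/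
noncomputable def csA (n : ℕ) :
    CoxeterSystem (CoxeterMatrix.Aₙ (n - 1)) (CoxeterMatrix.Aₙ (n - 1)).Group :=
  (CoxeterMatrix.Aₙ (n - 1)).toCoxeterSystem

/-- `w` is a longest element. -/
def IsLongest {B : Type*} {W : Type*} [Group W] {M : CoxeterMatrix B}
    (cs : CoxeterSystem M W) (w : W) : Prop :=
  ∀ v : W, cs.length v ≤ cs.length w

namespace PW

/-! ### Normal forms for commutation classes -/

variable {m : ℕ}

/-- Insert a letter, moving it right past much smaller letters. -/
def ins (a : Fin m) : List (Fin m) → List (Fin m)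
  | [] => [a]
  | b :: v => if b.val + 1 < a.val then b :: ins a v else a :: b :: v

/-- The lexicographic normal form. -/
def nf : List (Fin m) → List (Fin m)
  | [] => []
  | a :: v => ins a (nf v)

/-- Normal words: descents are by at most one. -/
def nrm : ℕ → List (Fin m) → Prop
  | _, [] => True
  | last, c :: v => last ≤ c.val + 1 ∧ nrm c.val v

theorem ins_comm_aux (a b : Fin m) (h : a.val + 1 < b.val) (v : List (Fin m)) :
    ins a (ins b v) = ins b (ins a v) := by
  induction v with
  | nil =>
    have : ¬ (b.val + 1 < a.val) := by omega
    simp [ins, h, this]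
  | cons c v ih =>
    have hba : ¬ (b.val + 1 < a.val) := by omega
    by_cases h1 : c.val + 1 < a.val
    · have h2 : c.val + 1 < b.val := by omega
      simp [ins, h1, h2, ih]
    · by_cases h2 : c.val + 1 < b.val
      · simp [ins, h1, h2, h]
      · simp [ins, h1, h2, h, hba]

theorem ins_comm (a b : Fin m) (h : a.val + 1 < b.val ∨ b.val + 1 < a.val) (v : List (Fin m)) :
    ins a (ins b v) = ins b (ins a v) := by
  rcases h with h | h
  · exact ins_comm_aux a b h v
  · exact (ins_comm_aux b a h v).symm

theorem nrm_ins (a : Fin m) (v : List (Fin m)) (last : ℕ) (hv : nrm last v)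
    (h : last ≤ a.val + 1) : nrm last (ins a v) := by
  induction v generalizing last with
  | nil => simpa [ins, nrm] using h
  | cons b v ih =>
    obtain ⟨h1, h2⟩ := hv
    by_cases hb : b.val + 1 < a.val
    · simp only [ins, hb, if_true]
      exact ⟨h1, ih _ h2 (by omega)⟩
    · simp only [ins, hb, if_false]
      exact ⟨h, by omega, h2⟩

theorem nrm_nf (v : List (Fin m)) : nrm 0 (nf v) := by
  induction v with
  | nil => trivial
  | cons a v ih => exact nrm_ins a _ 0 ih (by omega)

theorem nf_of_nrm (v : List (Fin m)) (last : ℕ) (h : nrm last v) : nf v = v := by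
  induction v generalizing last with
  | nil => rfl
  | cons a v ih =>
    obtain ⟨h1, h2⟩ := h
    rw [nf, ih _ h2]
    cases v with
    | nil => rfl
    | cons b v =>
      have : ¬ (b.val + 1 < a.val) := by have := h2.1; omega
      simp [ins, this]

/-- Commutation of letters. -/
def Com (a b : Fin m) : Prop := a.val + 1 < b.val ∨ b.val + 1 < a.val

theorem nf_swap (u v : List (Fin m)) (h : SwapStep Com u v) : nf u = nf v := by
  obtain ⟨x, y, a, b, hab, rfl, rfl⟩ := h
  induction x with
  | nil => exact ins_comm a b hab _
  | cons c x ih => simp only [List.cons_append, nf, ih]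

theorem swap_cons (c : Fin m) (u v : List (Fin m)) (h : SwapStep Com u v) :
    SwapStep Com (c :: u) (c :: v) := by
  obtain ⟨x, y, a, b, hab, rfl, rfl⟩ := h
  exact ⟨c :: x, y, a, b, hab, rfl, rfl⟩

theorem star_cons (c : Fin m) (u v : List (Fin m)) (h : Relation.ReflTransGen (SwapStep Com) u v) :
    Relation.ReflTransGen (SwapStep Com) (c :: u) (c :: v) := by
  induction h with
  | refl => exact .refl
  | tail _ h ih => exact ih.tail (swap_cons c _ _ h)

theorem star_ins (a : Fin m) (v : List (Fin m)) :
    Relation.ReflTransGen (SwapStep Com) (a :: v) (ins a v) := by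
  induction v with
  | nil => exact .refl
  | cons b v ih =>
    by_cases hb : b.val + 1 < a.val
    · simp only [ins, hb, if_true]
      exact .head ⟨[], v, a, b, Or.inr hb, rfl, rfl⟩ (star_cons b _ _ ih)
    · simp only [ins, hb, if_false]
      exact .refl

theorem star_nf (v : List (Fin m)) : Relation.ReflTransGen (SwapStep Com) v (nf v) := by
  induction v with
  | nil => exact .refl
  | cons a v ih => exact (star_cons a _ _ ih).trans (star_ins a _)

theorem quot_card (p : List (Fin m) → Prop) (hp : ∀ u v, SwapStep Com u v → p u → p v) :
    Nat.card (Quot (fun u v : {ω : List (Fin m) // p ω} => SwapStep Com u.1 v.1)) =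
      Nat.card {ω : List (Fin m) // p ω ∧ nrm 0 ω} := by
  have key : ∀ u v (_ : Relation.ReflTransGen (SwapStep Com) u v) (hu : p u),
      ∃ hv : p v, Quot.mk (fun u v : {ω : List (Fin m) // p ω} => SwapStep Com u.1 v.1) ⟨u, hu⟩
        = Quot.mk _ ⟨v, hv⟩ := by
    intro u v h hu
    induction h with
    | refl => exact ⟨hu, rfl⟩
    | tail _ h ih =>
      obtain ⟨hb, e⟩ := ih
      refine ⟨hp _ _ h hb, e.trans (Quot.sound h)⟩
  refine Nat.card_congr
    { toFun := Quot.lift (fun u => ⟨nf u.1, (key _ _ (star_nf u.1) u.2).1, nrm_nf _⟩)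
        (fun u v h => Subtype.ext (nf_swap _ _ h))
      invFun := fun u => Quot.mk _ ⟨u.1, u.2.1⟩
      left_inv := ?_
      right_inv := ?_ }
  · rintro ⟨u⟩
    exact (key _ _ (star_nf u.1) u.2).2.symm
  · rintro ⟨u, h1, h2⟩
    exact Subtype.ext (nf_of_nrm u 0 h2)

/-! ### Lists, adjacent swaps and inversions -/

/-- Swap positions `i`, `i+1`. -/
def step : ℕ → List ℕ → List ℕ
  | 0, a :: b :: l => b :: a :: l
  | i + 1, a :: l => a :: step i l
  | _, l => l

/-- Ascent at position `i`. -/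
def asc : ℕ → List ℕ → Bool
  | 0, a :: b :: _ => Nat.blt a b
  | i + 1, _ :: l => asc i l
  | _, _ => false

/-- Inversion number. -/
def inv : List ℕ → ℕ
  | [] => 0
  | a :: l => l.countP (fun x => decide (x < a)) + inv l

theorem step_perm (i : ℕ) (l : List ℕ) : (step i l).Perm l := by
  induction l generalizing i with
  | nil => cases i <;> simp [step]
  | cons a l ih =>
    cases i with
    | zero => cases l with
      | nil => simp [step]
      | cons b l => exact List.Perm.swap a b l
    | succ i => exact (ih i).cons a

theorem inv_step (i : ℕ) (l : List ℕ) :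
    (asc i l = true → inv (step i l) = inv l + 1) ∧
    (asc i l = false → inv (step i l) ≤ inv l) := by
  induction l generalizing i with
  | nil => cases i <;> simp [step, asc]
  | cons a l ih =>
    cases i with
    | zero => cases l with
      | nil => simp [step, asc]
      | cons b l =>
        simp only [step, asc, inv, List.countP_cons]
        constructor
        · intro h
          have : a < b := by simpa [Nat.blt_eq] using h
          have h2 : ¬ b < a := by omega
          simp [this, h2]; omega
        · intro h
          have : ¬ a < b := by
            intro h'; rw [← Nat.blt_eq] at h'; simp [h'] at h
          simp [this]; omega
    | succ i =>
      obtain ⟨h1, h2⟩ := ih i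
      simp only [step, asc, inv, (step_perm i l).countP_eq]
      constructor
      · intro h; have := h1 h; omega
      · intro h; have := h2 h; omega

theorem inv_step_le (i : ℕ) (l : List ℕ) : inv (step i l) ≤ inv l + 1 := by
  have := inv_step i l
  cases h : asc i l
  · have := this.2 h; omega
  · have := this.1 h; omega

/-- Apply a word to a list. -/
def run (σ : List ℕ) : List (Fin m) → List ℕ
  | [] => σ
  | c :: v => run (step c.val σ) v

theorem inv_run_le (σ : List ℕ) (v : List (Fin m)) : inv (run σ v) ≤ inv σ + v.length := by
  induction v generalizing σ with
  | nil => simp [run]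
  | cons c v ih =>
    have := ih (step c.val σ)
    have := inv_step_le c.val σ
    simp only [run, List.length_cons]; omega

/-- Words all of whose steps are ascents and which are normal. -/
def good : ℕ → List ℕ → List (Fin m) → Prop
  | _, _, [] => True
  | last, σ, c :: v => (last ≤ c.val + 1 ∧ asc c.val σ = true) ∧ good c.val (step c.val σ) v

theorem good_iff (last : ℕ) (σ : List ℕ) (v : List (Fin m)) :
    good last σ v ↔ inv (run σ v) = inv σ + v.length ∧ nrm last v := by
  induction v generalizing last σ with
  | nil => simp [good, run, nrm]
  | cons c v ih =>
    simp only [good, run, nrm, ih, List.length_cons]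
    have h3 := inv_run_le (step c.val σ) v
    have := inv_step c.val σ
    cases h : asc c.val σ
    · have := this.2 h
      constructor
      · simp
      · rintro ⟨h1, -⟩; omega
    · have := this.1 h
      constructor
      · rintro ⟨⟨h1, -⟩, h2, h4⟩; exact ⟨by omega, h1, h4⟩
      · rintro ⟨h1, h2, h4⟩; exact ⟨⟨h2, rfl⟩, by omega, h4⟩

/-- Enumeration of good words of length `k`. -/
def words (m : ℕ) : ℕ → ℕ → List ℕ → List (List (Fin m))
  | 0, _, _ => [[]]
  | k + 1, last, σ => (List.finRange m).flatMap fun c =>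
      if (Nat.ble last (c.val + 1) && asc c.val σ) = true then
        (words m k c.val (step c.val σ)).map (c :: ·) else []

theorem mem_words (k last : ℕ) (σ : List ℕ) (v : List (Fin m)) :
    v ∈ words m k last σ ↔ v.length = k ∧ good last σ v := by
  induction k generalizing last σ v with
  | zero =>
    simp only [words, List.mem_singleton, List.length_eq_zero_iff]
    constructor
    · rintro rfl; exact ⟨rfl, trivial⟩
    · exact fun h => h.1
  | succ k ih =>
    simp only [words, List.mem_flatMap, List.mem_finRange, true_and]
    constructor
    · rintro ⟨c, hc⟩
      split_ifs at hc with h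
      · obtain ⟨w, hw, rfl⟩ := List.mem_map.1 hc
        obtain ⟨h1, h2⟩ := (ih _ _ _).1 hw
        simp only [Bool.and_eq_true, Nat.ble_eq] at h
        exact ⟨by simp [h1], h, h2⟩
      · simp at hc
    · rintro ⟨h1, h2⟩
      cases v with
      | nil => simp at h1
      | cons c v =>
        refine ⟨c, ?_⟩
        have h : (Nat.ble last (c.val + 1) && asc c.val σ) = true := by
          simp only [Bool.and_eq_true, Nat.ble_eq]; exact h2.1
        rw [if_pos h]
        exact List.mem_map.2 ⟨v, (ih _ _ _).2 ⟨by simpa using h1, h2.2⟩, rfl⟩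

theorem nodup_words (k last : ℕ) (σ : List ℕ) : (words m k last σ).Nodup := by
  induction k generalizing last σ with
  | zero => simp [words]
  | succ k ih =>
    rw [words, List.nodup_flatMap]
    constructor
    · intro c _
      split_ifs
      · exact (ih _ _).map (fun a b h => by simpa using h)
      · simp
    · refine (List.nodup_finRange m).imp ?_
      intro a b hab x hx hy
      dsimp only at hx hy
      split_ifs at hx hy <;> simp_all
      obtain ⟨u, _, rfl⟩ := hx
      obtain ⟨w, _, hw⟩ := hy
      exact hab (List.cons.inj hw).1.symm

/-- Count of good words. -/
def cnt (r : List ℕ) : ℕ → ℕ → List ℕ → ℕ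
  | 0, _, _ => 1
  | k + 1, last, σ => r.foldr (fun c acc =>
      (bif Nat.ble last (c + 1) && asc c σ then cnt r k c (step c σ) else 0) + acc) 0

theorem length_words (k last : ℕ) (σ : List ℕ) :
    (words m k last σ).length = cnt ((List.finRange m).map Fin.val) k last σ := by
  induction k generalizing last σ with
  | zero => simp [words, cnt]
  | succ k ih =>
    rw [words, cnt, List.foldr_map]
    generalize hr : (List.finRange m).map Fin.val = r at ih ⊢
    clear hr
    generalize List.finRange m = L
    induction L with
    | nil => rfl
    | cons c L ih2 =>
      rw [List.flatMap_cons, List.length_append, ih2, List.foldr_cons]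
      congr 1
      cases h : (Nat.ble last (c.val + 1) && asc c.val σ)
      · simp
      · simp [ih]

theorem card_good (k last : ℕ) (σ : List ℕ) :
    Nat.card {v : List (Fin m) // v.length = k ∧ good last σ v} =
      cnt ((List.finRange m).map Fin.val) k last σ := by
  rw [← length_words, ← List.toFinset_card_of_nodup (nodup_words k last σ)]
  rw [← Nat.card_eq_finsetCard]
  refine Nat.card_congr (Equiv.subtypeEquivRight fun v => ?_)
  rw [List.mem_toFinset, mem_words]

/-! ### The permutation representation -/

theorem step_range' (f : ℕ → ℕ) (i a n : ℕ) (h : i + 1 < n) :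
    (List.range' a n).map (fun x => f (Equiv.swap (a + i) (a + i + 1) x)) =
      step i ((List.range' a n).map f) := by
  induction i generalizing a n with
  | zero =>
    obtain ⟨n, rfl⟩ : ∃ k, n = k + 2 := ⟨n - 2, by omega⟩
    simp only [List.range'_succ, List.map_cons, step, add_zero, Equiv.swap_apply_left,
      Equiv.swap_apply_right]
    congr 2
    refine List.map_congr_left fun x hx => ?_
    have := (List.mem_range'_1.1 hx).1
    rw [Equiv.swap_apply_of_ne_of_ne] <;> omega
  | succ i ih =>
    obtain ⟨n, rfl⟩ : ∃ k, n = k + 1 := ⟨n - 1, by omega⟩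
    simp only [List.range'_succ, List.map_cons, step]
    rw [← ih (a + 1) n (by omega)]
    congr 1
    · rw [Equiv.swap_apply_of_ne_of_ne] <;> omega
    · have : a + (i + 1) = a + 1 + i := by omega
      rw [this]

/-- One-line notation. -/
def lst (n : ℕ) (π : Equiv.Perm ℕ) : List ℕ := (List.range' 0 n).map π

theorem lst_mul (n i : ℕ) (π : Equiv.Perm ℕ) (h : i + 1 < n) :
    lst n (π * Equiv.swap i (i + 1)) = step i (lst n π) := by
  have := step_range' π i 0 n h
  simpa [lst, Function.comp_def] using this

theorem A_apply (i j : Fin m) : CoxeterMatrix.Aₙ m i j = if i = j then 1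
      else (if (j : ℕ) + 1 = i ∨ (i : ℕ) + 1 = j then 3 else 2) := rfl

theorem com_iff (i j : Fin m) : CoxeterMatrix.Aₙ m i j = 2 ↔ Com i j := by
  rw [A_apply, Com]
  split_ifs with h1 h2
  · subst h1; simp
  · simp; omega
  · simp; have : i.val ≠ j.val := fun h => h1 (Fin.ext h)
    omega

theorem swap_pow3 (i : ℕ) :
    (Equiv.swap i (i + 1) * Equiv.swap (i + 1) (i + 2)) ^ 3 = 1 := by
  ext x
  simp only [pow_succ, pow_zero, one_mul, Equiv.Perm.mul_apply, Equiv.Perm.one_apply,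
    Equiv.swap_apply_def]
  grind

theorem swap_pow3' (i : ℕ) :
    (Equiv.swap (i + 1) (i + 2) * Equiv.swap i (i + 1)) ^ 3 = 1 := by
  ext x
  simp only [pow_succ, pow_zero, one_mul, Equiv.Perm.mul_apply, Equiv.Perm.one_apply,
    Equiv.swap_apply_def]
  grind

theorem swap_pow2 (i j : ℕ) (h : i + 1 < j ∨ j + 1 < i) :
    (Equiv.swap i (i + 1) * Equiv.swap j (j + 1)) ^ 2 = 1 := by
  ext x
  simp only [pow_succ, pow_zero, one_mul, Equiv.Perm.mul_apply, Equiv.Perm.one_apply,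
    Equiv.swap_apply_def]
  grind

theorem liftable (m : ℕ) : (CoxeterMatrix.Aₙ m).IsLiftable
    (fun i : Fin m => Equiv.swap i.val (i.val + 1)) := by
  intro i j
  rw [A_apply]
  dsimp only
  split_ifs with h1 h2
  · subst h1; simp
  · rcases h2 with h2 | h2
    · rw [← h2]; exact swap_pow3' _
    · rw [← h2]; exact swap_pow3 _
  · have : i.val ≠ j.val := fun h => h1 (Fin.ext h)
    exact swap_pow2 _ _ (by omega)

/-- The system. -/
noncomputable def cs (m : ℕ) : CoxeterSystem (CoxeterMatrix.Aₙ m) (CoxeterMatrix.Aₙ m).Group :=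
  (CoxeterMatrix.Aₙ m).toCoxeterSystem

/-- The representation. -/
noncomputable def phi (m : ℕ) : (CoxeterMatrix.Aₙ m).Group →* Equiv.Perm ℕ :=
  (cs m).lift ⟨_, liftable m⟩

theorem phi_simple (i : Fin m) : phi m ((cs m).simple i) = Equiv.swap i.val (i.val + 1) :=
  (cs m).lift_apply_simple (liftable m) i

theorem lst_word (v : List (Fin m)) (π : Equiv.Perm ℕ) :
    lst (m + 1) (π * phi m ((cs m).wordProd v)) = run (lst (m + 1) π) v := by
  induction v generalizing π with
  | nil => simp [run]
  | cons c v ih =>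
    rw [CoxeterSystem.wordProd_cons, map_mul, ← mul_assoc, ih, phi_simple, lst_mul _ _ _ (by omega),
      run]

/-- The starting list. -/
def idl (n : ℕ) : List ℕ := List.range' 0 n

theorem lst_word' (v : List (Fin m)) :
    lst (m + 1) (phi m ((cs m).wordProd v)) = run (idl (m + 1)) v := by
  have := lst_word v 1
  simpa [lst, idl] using this

theorem inv_range' (a n : ℕ) : inv (List.range' a n) = 0 := by
  induction n generalizing a with
  | zero => rfl
  | succ n ih =>
    rw [List.range'_succ, inv, ih, List.countP_eq_zero.2]
    intro x hx
    have := (List.mem_range'_1.1 hx).1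
    simp; omega

theorem inv_le_length (w : (CoxeterMatrix.Aₙ m).Group) :
    inv (lst (m + 1) (phi m w)) ≤ (cs m).length w := by
  obtain ⟨v, hv, rfl⟩ := (cs m).exists_isReduced w
  rw [lst_word', hv.eq]
  have := inv_run_le (idl (m + 1)) v
  rwa [idl, inv_range', zero_add] at this

/-! ### Upper bound and uniqueness of the longest element -/

/-- Descending words. -/
def desc (k j : ℕ) : List ℕ := (List.range j).map (fun t => k - t)

/-- The full word. -/
def full : ℕ → List ℕ
  | 0 => []
  | k + 1 => full k ++ desc k (k + 1)

/-- Triangular numbers. -/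
def tri : ℕ → ℕ
  | 0 => 0
  | k + 1 => tri k + (k + 1)

/-- Standard words. -/
def IsX : ℕ → List ℕ → Prop
  | 0, ω => ω = []
  | k + 1, ω => ∃ v j, IsX k v ∧ j ≤ k + 1 ∧ ω = v ++ desc k j

theorem IsX_length (k : ℕ) (ω : List ℕ) (h : IsX k ω) :
    ω.length ≤ tri k ∧ (ω.length = tri k → ω = full k) := by
  induction k generalizing ω with
  | zero => simp [IsX] at h; subst h; simp [full]
  | succ k ih =>
    obtain ⟨v, j, hv, hj, rfl⟩ := h
    obtain ⟨h1, h2⟩ := ih v hv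
    simp only [List.length_append, desc, List.length_map, List.length_range, tri, full]
    refine ⟨by omega, fun h => ?_⟩
    rw [h2 (by omega), show j = k + 1 by omega]

/-- Simple reflections indexed by naturals. -/
noncomputable def S (m i : ℕ) : (CoxeterMatrix.Aₙ m).Group :=
  if h : i < m then (cs m).simple ⟨i, h⟩ else 1

theorem S_sq (i : ℕ) : S m i * S m i = 1 := by
  unfold S; split_ifs <;> simp

theorem S_comm (i j : ℕ) (h : i + 1 < j) : S m i * S m j = S m j * S m i := by
  unfold S
  split_ifs with h1 h2
  · have := (cs m).simple_mul_simple_pow ⟨i, h1⟩ ⟨j, h2⟩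
    rw [(com_iff _ _).2 (Or.inl h), pow_two] at this
    have := eq_inv_of_mul_eq_one_left this
    rw [this]; simp
  all_goals simp

theorem S_braid (i : ℕ) (h : i + 1 < m) :
    S m (i + 1) * S m i * S m (i + 1) = S m i * S m (i + 1) * S m i := by
  have h1 : i < m := by omega
  simp only [S, h, h1, dif_pos]
  have := (cs m).simple_mul_simple_pow ⟨i, h1⟩ ⟨i + 1, h⟩
  have e : CoxeterMatrix.Aₙ m ⟨i, h1⟩ ⟨i + 1, h⟩ = 3 := by
    rw [A_apply]; simp
  rw [e] at this
  generalize ha : (cs m).simple ⟨i, h1⟩ = a at this ⊢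
  generalize hb : (cs m).simple ⟨i + 1, h⟩ = b at this ⊢
  have ia : a⁻¹ = a := by rw [← ha]; simp
  have ib : b⁻¹ = b := by rw [← hb]; simp
  have h5 : (a * b * a) * (b * a * b) = 1 := by
    rw [← this]; simp only [pow_succ, pow_zero, one_mul, mul_assoc]
  have := eq_inv_of_mul_eq_one_right h5
  rw [this]
  simp [mul_assoc, ia, ib]

/-- Product of a word in naturals. -/
noncomputable def wp (m : ℕ) (ω : List ℕ) : (CoxeterMatrix.Aₙ m).Group := (ω.map (S m)).prod

theorem wp_append (u v : List ℕ) : wp m (u ++ v) = wp m u * wp m v := by simp [wp]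

theorem D_succ (k j : ℕ) : wp m (desc k (j + 1)) = wp m (desc k j) * S m (k - j) := by
  simp [wp, desc, List.range_succ]

theorem D_comm (k j i : ℕ) (h : i + j < k) :
    wp m (desc k j) * S m i = S m i * wp m (desc k j) := by
  induction j with
  | zero => simp [wp, desc]
  | succ j ih =>
    rw [D_succ, mul_assoc, ← S_comm i (k - j) (by omega), ← mul_assoc, ih (by omega), mul_assoc]

theorem D_shift (k j i : ℕ) (hk : k < m) (hj : j ≤ k + 1) (h : k + 1 < i + 1 + j) (hi : i + 1 ≤ k) :
    wp m (desc k j) * S m (i + 1) = S m i * wp m (desc k j) := by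
  induction j with
  | zero => omega
  | succ j ih =>
    by_cases h1 : k + 1 < i + 1 + j
    · rw [D_succ, mul_assoc, S_comm (k - j) (i + 1) (by omega), ← mul_assoc, ih (by omega) h1,
        mul_assoc]
    · obtain ⟨j, rfl⟩ : ∃ t, j = t + 1 := ⟨j - 1, by omega⟩
      have e1 : k - j = i + 1 := by omega
      have e2 : k - (j + 1) = i := by omega
      rw [D_succ, D_succ, e1, e2]
      have := S_braid (m := m) i (by omega)
      calc _ = wp m (desc k j) * (S m (i + 1) * S m i * S m (i + 1)) := by group
        _ = wp m (desc k j) * S m i * S m (i + 1) * S m i := by rw [this]; group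
        _ = _ := by rw [D_comm k j i (by omega)]; group

theorem X_closed (k : ℕ) (hk : k ≤ m) (ω : List ℕ) (h : IsX k ω) (i : ℕ) (hi : i < k) :
    ∃ ω', IsX k ω' ∧ wp m ω' = wp m ω * S m i := by
  induction k generalizing ω i with
  | zero => omega
  | succ k ih =>
    obtain ⟨v, j, hv, hj, rfl⟩ := h
    rcases lt_trichotomy (i + j) k with h1 | h1 | h1
    · obtain ⟨v', hv', e⟩ := ih (by omega) v hv i (by omega)
      refine ⟨v' ++ desc k j, ⟨v', j, hv', hj, rfl⟩, ?_⟩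
      rw [wp_append, wp_append, e, mul_assoc, mul_assoc, D_comm k j i h1]
    · refine ⟨v ++ desc k (j + 1), ⟨v, j + 1, hv, by omega, rfl⟩, ?_⟩
      rw [wp_append, wp_append, D_succ, show k - j = i by omega, mul_assoc]
    · by_cases h2 : i + j = k + 1
      · obtain ⟨j, rfl⟩ : ∃ t, j = t + 1 := ⟨j - 1, by omega⟩
        refine ⟨v ++ desc k j, ⟨v, j, hv, by omega, rfl⟩, ?_⟩
        rw [wp_append, wp_append, D_succ, show k - j = i by omega, mul_assoc, mul_assoc, S_sq,
          mul_one]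
      · obtain ⟨i, rfl⟩ : ∃ t, i = t + 1 := ⟨i - 1, by omega⟩
        obtain ⟨v', hv', e⟩ := ih (by omega) v hv i (by omega)
        refine ⟨v' ++ desc k j, ⟨v', j, hv', hj, rfl⟩, ?_⟩
        rw [wp_append, wp_append, e, mul_assoc, mul_assoc,
          D_shift k j i (by omega) hj (by omega) (by omega)]

theorem X_nil (k : ℕ) : IsX k [] := by
  induction k with
  | zero => rfl
  | succ k ih => exact ⟨[], 0, ih, by omega, by simp [desc]⟩

theorem X_all (w : (CoxeterMatrix.Aₙ m).Group) : ∃ ω, IsX m ω ∧ wp m ω = w := by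
  induction w using (cs m).simple_induction_right with
  | one => exact ⟨[], X_nil m, by simp [wp]⟩
  | mul_simple_right w i ih =>
    obtain ⟨ω, h, rfl⟩ := ih
    obtain ⟨ω', h', e⟩ := X_closed m le_rfl ω h i i.2
    refine ⟨ω', h', e.trans ?_⟩
    simp [S]

theorem length_wp (ω : List ℕ) : (cs m).length (wp m ω) ≤ ω.length := by
  induction ω with
  | nil => simp [wp]
  | cons c v ih =>
    have h1 : wp m (c :: v) = S m c * wp m v := by simp [wp]
    have h2 := (cs m).length_mul_le (S m c) (wp m v)
    have h3 : (cs m).length (S m c) ≤ 1 := by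
      unfold S; split_ifs
      · simp
      · simp
    rw [h1, List.length_cons]; omega

theorem length_le (w : (CoxeterMatrix.Aₙ m).Group) :
    (cs m).length w ≤ tri m ∧ ((cs m).length w = tri m → w = wp m (full m)) := by
  obtain ⟨ω, h, rfl⟩ := X_all w
  have h1 := length_wp (m := m) ω
  obtain ⟨h2, h3⟩ := IsX_length m ω h
  exact ⟨by omega, fun e => by rw [h3 (by omega)]⟩

/-! ### Main count -/

theorem main (m : ℕ) (v₀ : List (Fin m)) (hv₀ : inv (run (idl (m + 1)) v₀) = tri m)
    (w : (CoxeterMatrix.Aₙ m).Group) (hw : IsLongest (cs m) w) :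
    CC (cs m) w = cnt ((List.finRange m).map Fin.val) (tri m) 0 (idl (m + 1)) := by
  have big : ∀ v : List (Fin m), inv (run (idl (m + 1)) v) = tri m →
      (cs m).length ((cs m).wordProd v) = tri m := by
    intro v hv
    have h1 := inv_le_length ((cs m).wordProd v)
    rw [lst_word', hv] at h1
    exact le_antisymm (length_le _).1 h1
  have lw : (cs m).length w = tri m := by
    have := hw ((cs m).wordProd v₀)
    rw [big v₀ hv₀] at this
    exact le_antisymm (length_le _).1 this
  have ew : ∀ u, (cs m).length u = tri m → u = w := fun u hu =>
    ((length_le u).2 hu).trans ((length_le w).2 lw).symm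
  have hinv : inv (lst (m + 1) (phi m w)) = tri m := by
    rw [← ew _ (big v₀ hv₀), lst_word', hv₀]
  have hrel : (fun a b : Fin m => CoxeterMatrix.Aₙ m a b = 2) = Com := by
    funext a b; exact propext (com_iff a b)
  rw [CC, hrel, quot_card]
  · rw [← card_good]
    refine Nat.card_congr (Equiv.subtypeEquivRight fun v => ?_)
    rw [good_iff, show inv (idl (m + 1)) = 0 from inv_range' _ _, zero_add]
    constructor
    · rintro ⟨⟨rfl, h2⟩, h3⟩
      have : v.length = tri m := by rw [← h2.eq, lw]
      refine ⟨this, ?_, h3⟩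
      rw [← lst_word', hinv, this]
    · rintro ⟨h1, h2, h3⟩
      have h4 := big v (h2.trans h1)
      exact ⟨⟨ew _ h4, h4.trans h1.symm⟩, h3⟩
  · rintro u v ⟨x, y, a, b, hab, rfl, rfl⟩ ⟨h1, h2⟩
    have e : (cs m).wordProd (x ++ b :: a :: y) = (cs m).wordProd (x ++ a :: b :: y) := by
      have h3 : (cs m).simple b * (cs m).simple a = (cs m).simple a * (cs m).simple b := by
        have ha : (cs m).simple a = S m a.val := by simp [S]
        have hb : (cs m).simple b = S m b.val := by simp [S]
        rw [ha, hb]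
        rcases hab with h | h
        · exact (S_comm _ _ h).symm
        · exact S_comm _ _ h
      simp only [CoxeterSystem.wordProd_append, CoxeterSystem.wordProd_cons]
      rw [← mul_assoc ((cs m).simple b), h3, mul_assoc]
    refine ⟨e.trans h1, ?_⟩
    rw [CoxeterSystem.IsReduced, e, h2.eq]
    simp

end PW

/-- The first six values of `P(n) = C(w₀)`, for `w₀` the longest element of `Sₙ`:
`1, 1, 2, 8, 62, 908`. -/
theorem stmt17 :
    (∀ w₀, IsLongest (csA 1) w₀ → CC (csA 1) w₀ = 1) ∧
    (∀ w₀, IsLongest (csA 2) w₀ → CC (csA 2) w₀ = 1) ∧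
    (∀ w₀, IsLongest (csA 3) w₀ → CC (csA 3) w₀ = 2) ∧
    (∀ w₀, IsLongest (csA 4) w₀ → CC (csA 4) w₀ = 8) ∧
    (∀ w₀, IsLongest (csA 5) w₀ → CC (csA 5) w₀ = 62) ∧
    (∀ w₀, IsLongest (csA 6) w₀ → CC (csA 6) w₀ = 908) := by
  refine ⟨fun w h => ?_, fun w h => ?_, fun w h => ?_, fun w h => ?_, fun w h => ?_, fun w h => ?_⟩
  · exact (PW.main 0 [] (by decide) w h).trans (by decide +kernel)
  · exact (PW.main 1 [0] (by decide) w h).trans (by decide +kernel)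
  · exact (PW.main 2 [0, 1, 0] (by decide) w h).trans (by decide +kernel)
  · exact (PW.main 3 [0, 1, 0, 2, 1, 0] (by decide) w h).trans (by decide +kernel)
  · exact (PW.main 4 [0, 1, 0, 2, 1, 0, 3, 2, 1, 0] (by decide +kernel) w h).trans
      (by decide +kernel)
  · exact (PW.main 5 [0, 1, 0, 2, 1, 0, 3, 2, 1, 0, 4, 3, 2, 1, 0] (by decide +kernel) w h).trans
      (by decide +kernel)
end
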